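/- In the additive spiked model with aspect ratio p/n → δ ≥ 0 and fixed signal strength λ satisfying λ > δ^{1/4}, the absolute inner product |⟨v̂, v*⟩| between the top unit eigenvector v̂ of XᵀX and the true spike direction v* converges in probability, as n → ∞, to √((1 − δ/λ⁴)/(1 + δ/λ²)). -/

import Mathlib

open MeasureTheory ProbabilityTheory Filter Matrix
open scoped NNReal ENNReal

noncomputable section

/-- Euclidean inner product on `Fin m → ℝ`. -/
def dotp {m : ℕ} (v w : Fin m → ℝ) : ℝ := ∑ j, v j * w j

/-- `v` is a unit-norm eigenvector of the square matrix `M` associated with its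
largest eigenvalue. -/
def IsTopUnitEigenvector {m : ℕ} (M : Matrix (Fin m) (Fin m) ℝ) (v : Fin m → ℝ) : Prop :=
  dotp v v = 1 ∧ ∃ c : ℝ, M.mulVec v = c • v ∧
    ∀ c' : ℝ, ∀ w : Fin m → ℝ, w ≠ 0 → M.mulVec w = c' • w → c' ≤ c

/-- The law of the randomness `(u, Z)` in the additive spiked model: `u ∈ ℝⁿ` has i.i.d.
`N(0, 1/n)` entries, and independently `Z ∈ ℝ^{n×p}` has i.i.d. `N(0, 1/n)` entries. -/
def spikedLaw (n p : ℕ) : Measure ((Fin n → ℝ) × (Fin n → Fin p → ℝ)) :=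
  (Measure.pi fun _ : Fin n => gaussianReal 0 (n : ℝ≥0)⁻¹).prod
    (Measure.pi fun _ : Fin n => Measure.pi fun _ : Fin p => gaussianReal 0 (n : ℝ≥0)⁻¹)

/-- The data matrix `X = λ u v*ᵀ + Z` of the additive spiked model. -/
def spikedMatrix {n p : ℕ} (lam : ℝ) (vstar : Fin p → ℝ) (u : Fin n → ℝ)
    (Z : Fin n → Fin p → ℝ) : Matrix (Fin n) (Fin p) ℝ :=
  Matrix.of fun i j => lam * u i * vstar j + Z i j


lemma mp_update {ι : Type*} [Fintype ι] [DecidableEq ι] {α : ι → Type*}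
    [∀ i, MeasurableSpace (α i)] (μ : ∀ i, Measure (α i)) [∀ i, IsProbabilityMeasure (μ i)] (k : ι) :
    MeasurePreserving (fun q : (∀ i, α i) × α k => Function.update q.1 k q.2)
      ((Measure.pi μ).prod (μ k)) (Measure.pi μ) := by
  have hm : Measurable (fun q : (∀ i, α i) × α k => Function.update q.1 k q.2) := by
    refine measurable_pi_iff.2 fun j => ?_
    by_cases h : j = k
    · subst h; simpa using measurable_snd
    · simp only [Function.update_of_ne h]
      exact (measurable_pi_apply j).comp measurable_fst
  refine ⟨hm, (Measure.pi_eq fun s hs => ?_).symm⟩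
  rw [Measure.map_apply hm (MeasurableSet.univ_pi hs)]
  have : (fun q : (∀ i, α i) × α k => Function.update q.1 k q.2) ⁻¹' (Set.univ.pi s)
      = (Set.univ.pi (Function.update s k Set.univ)) ×ˢ (s k) := by
    ext ⟨g, y⟩
    simp only [Set.mem_preimage, Set.mem_pi, Set.mem_univ, true_implies, Set.mem_prod]
    constructor
    · intro h
      refine ⟨fun j => ?_, by simpa using h k⟩
      by_cases hj : j = k
      · subst hj; simp
      · simpa [Function.update_of_ne hj] using h j
    · rintro ⟨h1, h2⟩ j
      by_cases hj : j = k
      · subst hj; simpa using h2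
      · simpa [Function.update_of_ne hj] using h1 j
  rw [this, Measure.prod_prod, Measure.pi_pi]
  rw [← Finset.mul_prod_erase _ _ (Finset.mem_univ k), ← Finset.mul_prod_erase _ (fun i => μ i (s i)) (Finset.mem_univ k)]
  simp only [Function.update_self, measure_univ, one_mul]
  rw [mul_comm]
  congr 1
  refine Finset.prod_congr rfl fun j hj => ?_
  rw [Function.update_of_ne (Finset.ne_of_mem_erase hj)]

lemma stein_real {v : ℝ≥0} (hv : v ≠ 0) {h h' : ℝ → ℝ} (hd : ∀ x, HasDerivAt h (h' x) x)
    (i1 : Integrable (fun x => x * h x) (gaussianReal 0 v))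
    (i2 : Integrable h' (gaussianReal 0 v)) (i3 : Integrable h (gaussianReal 0 v)) :
    ∫ x, x * h x ∂gaussianReal 0 v = v * ∫ x, h' x ∂gaussianReal 0 v := by
  have hv' : (v : ℝ) ≠ 0 := by exact_mod_cast hv
  have key : ∀ f : ℝ → ℝ, Integrable f (gaussianReal 0 v) → 
      Integrable (fun x => gaussianPDFReal 0 v x * f x) := by
    intro f hf
    rw [gaussianReal_of_var_ne_zero _ hv, integrable_withDensity_iff_integrable_smul₀' 
      (measurable_gaussianPDF 0 v).aemeasurable (by simp [gaussianPDF_lt_top])] at hf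
    simpa [toReal_gaussianPDF] using hf
  have hpd : ∀ x, HasDerivAt (gaussianPDFReal 0 v) (-(x / v) * gaussianPDFReal 0 v x) x := by
    intro x
    unfold gaussianPDFReal
    have h1 : HasDerivAt (fun x : ℝ => -(x - 0) ^ 2 / (2 * (v:ℝ))) (-(x / v)) x := by
      have := ((((hasDerivAt_id' x).sub_const 0).fun_pow 2).fun_neg).div_const (2 * (v:ℝ))
      refine this.congr_deriv ?_
      field_simp; simp [mul_comm]
    have h2 := (h1.exp).const_mul ((√(2 * Real.pi * v))⁻¹)
    refine h2.congr_deriv ?_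
    ring
  have e := integral_mul_deriv_eq_deriv_mul_of_integrable (u := h) (v := gaussianPDFReal 0 v)
    (u' := h') (v' := fun x => -(x / v) * gaussianPDFReal 0 v x) (fun x _ => hd x) (fun x _ => hpd x)
    (by
      have := (key _ i1).const_mul (-(1/(v:ℝ)))
      refine this.congr (Eventually.of_forall fun x => ?_)
      simp; ring)
    (by
      refine (key _ i2).congr (Eventually.of_forall fun x => ?_)
      simp; ring)
    (by
      refine (key _ i3).congr (Eventually.of_forall fun x => ?_)
      simp; ring)
  rw [integral_gaussianReal_eq_integral_smul hv, integral_gaussianReal_eq_integral_smul hv]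
  have e1 : ∫ x, gaussianPDFReal 0 v x • (x * h x) = -(v:ℝ) * ∫ x, h x * (-(x / v) * gaussianPDFReal 0 v x) := by
    rw [← integral_const_mul]
    congr 1; ext x; simp; field_simp
  rw [e1, e, ← mul_neg_one, ← integral_neg, ← integral_const_mul, ← integral_const_mul]
  congr 1; ext x; simp only [smul_eq_mul]; ring

lemma stein_pi {D : Type*} [Fintype D] [DecidableEq D] {v : ℝ≥0} (hv : v ≠ 0) (k : D) {H H' : (D → ℝ) → ℝ}
    (hd : ∀ g y, HasDerivAt (fun y => H (Function.update g k y)) (H' (Function.update g k y)) y)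
    (i1 : Integrable (fun g => g k * H g) (Measure.pi fun _ : D => gaussianReal 0 v))
    (i2 : Integrable H' (Measure.pi fun _ : D => gaussianReal 0 v))
    (i3 : Integrable H (Measure.pi fun _ : D => gaussianReal 0 v)) :
    ∫ g, g k * H g ∂(Measure.pi fun _ : D => gaussianReal 0 v)
      = v * ∫ g, H' g ∂(Measure.pi fun _ : D => gaussianReal 0 v) := by
  have mp := mp_update (fun _ : D => gaussianReal 0 v) k
  have tr : ∀ f : (D → ℝ) → ℝ, Integrable f (Measure.pi fun _ : D => gaussianReal 0 v) →
      Integrable (fun q : (D → ℝ) × ℝ => f (Function.update q.1 k q.2)) 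
        ((Measure.pi fun _ : D => gaussianReal 0 v).prod (gaussianReal 0 v)) ∧
      ∫ g, f g ∂(Measure.pi fun _ : D => gaussianReal 0 v) = 
       ∫ g, ∫ y, f (Function.update g k y) ∂gaussianReal 0 v ∂(Measure.pi fun _ : D => gaussianReal 0 v) := by
    intro f hf
    have a : Integrable (fun q : (D → ℝ) × ℝ => f (Function.update q.1 k q.2)) 
        ((Measure.pi fun _ : D => gaussianReal 0 v).prod (gaussianReal 0 v)) := 
      (mp.integrable_comp hf.aestronglyMeasurable).2 hf
    refine ⟨a, ?_⟩
    rw [← integral_prod _ a]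
    have := integral_map mp.measurable.aemeasurable (f := f) (by rw [mp.map_eq]; exact hf.aestronglyMeasurable)
    rw [mp.map_eq] at this
    exact this
  obtain ⟨a1, b1⟩ := tr _ i1
  obtain ⟨a2, b2⟩ := tr _ i2
  obtain ⟨a3, b3⟩ := tr _ i3
  rw [b1, b2, ← integral_const_mul]
  refine integral_congr_ae ?_
  filter_upwards [a1.prod_right_ae, a2.prod_right_ae, a3.prod_right_ae] with g h1 h2 h3
  simp only [Function.update_self] at h1 ⊢
  exact stein_real hv (hd g) h1 h2 h3


/-- flat Gaussian measure. -/
abbrev gpi (D : Type*) [Fintype D] (v : ℝ≥0) : Measure (D → ℝ) := Measure.pi fun _ : D => gaussianReal 0 v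

/-- all moments finite. -/
def AM {Ω : Type*} [MeasurableSpace Ω] (μ : Measure Ω) (f : Ω → ℝ) : Prop := ∀ q : ℕ, MemLp f q μ

section AMs
variable {Ω : Type*} [MeasurableSpace Ω] {μ : Measure Ω}

lemma AM.integrable {f : Ω → ℝ} (h : AM μ f) : Integrable f μ := by
  have := h 1
  rw [← memLp_one_iff_integrable]; exact_mod_cast this

lemma AM.add {f g : Ω → ℝ} (hf : AM μ f) (hg : AM μ g) : AM μ (fun x => f x + g x) := 
  fun q => (hf q).add (hg q)

lemma AM.sub {f g : Ω → ℝ} (hf : AM μ f) (hg : AM μ g) : AM μ (fun x => f x - g x) := 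
  fun q => (hf q).sub (hg q)

lemma AM.const_mul {f : Ω → ℝ} (c : ℝ) (hf : AM μ f) : AM μ (fun x => c * f x) := 
  fun q => (hf q).const_mul c

lemma AM.mul {f g : Ω → ℝ} (hf : AM μ f) (hg : AM μ g) : AM μ (fun x => f x * g x) := by
  intro q
  have h1 := hf (2*q)
  have h2 := hg (2*q)
  have : ENNReal.HolderTriple ((2*q : ℕ) : ℝ≥0∞) ((2*q : ℕ) : ℝ≥0∞) (q : ℝ≥0∞) := by
    constructor
    push_cast
    rw [ENNReal.mul_inv (by simp) (by simp), ← add_mul, ENNReal.inv_two_add_inv_two, one_mul]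
  exact h2.mul' h1

lemma AM.const [IsFiniteMeasure μ] (c : ℝ) : AM μ (fun _ => c) := fun _ => memLp_const c

lemma AM.sum {ι : Type*} (s : Finset ι) {f : ι → Ω → ℝ} (hf : ∀ i ∈ s, AM μ (f i)) : 
    AM μ (fun x => ∑ i ∈ s, f i x) := fun q => memLp_finsetSum s fun i hi => hf i hi q

lemma AM.congr {f g : Ω → ℝ} (hf : AM μ f) (h : ∀ x, f x = g x) : AM μ g := by
  have : f = g := funext h
  rwa [this] at hf
end AMs

section mom
variable {D : Type*} [Fintype D] {v : ℝ≥0}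

lemma AM.coord (k : D) : AM (gpi D v) (fun g => g k) := by
  intro q
  have h : MemLp (id : ℝ → ℝ) q (gaussianReal 0 v) := by
    have := memLp_id_gaussianReal (μ := 0) (v := v) (q : ℝ≥0); simpa using this
  have := (measurePreserving_eval (fun _ : D => gaussianReal 0 v) k)
  exact h.comp_measurePreserving this

/-- quadratic form. -/
def qf (A : D → D → ℝ) (g : D → ℝ) : ℝ := ∑ i, ∑ j, A i j * g i * g j

lemma AM.lin (a : D → ℝ) : AM (gpi D v) (fun g => ∑ j, a j * g j) :=
  AM.sum _ fun j _ => (AM.coord j).const_mul _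

lemma AM.qf (A : D → D → ℝ) : AM (gpi D v) (qf A) :=
  (AM.sum Finset.univ fun i _ => AM.sum Finset.univ fun j _ => 
    (((AM.coord i).const_mul (A i j)).mul (AM.coord j)))

variable [DecidableEq D]

lemma hd_coord (g : D → ℝ) (k j : D) (y : ℝ) : 
    HasDerivAt (fun y => Function.update g k y j) (if j = k then 1 else 0) y := by
  by_cases h : j = k
  · subst h; simpa using hasDerivAt_id' y
  · simpa [Function.update_of_ne h, h] using hasDerivAt_const y (g j)

lemma hd_lin (a : D → ℝ) (g : D → ℝ) (k : D) (y : ℝ) : 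
    HasDerivAt (fun y => ∑ j, a j * Function.update g k y j) (a k) y := by
  have := HasDerivAt.fun_sum (u := Finset.univ) (fun j _ => (hd_coord g k j y).const_mul (a j))
  refine this.congr_deriv ?_
  simp

lemma hd_qf (A : D → D → ℝ) (hA : ∀ i j, A i j = A j i) (g : D → ℝ) (k : D) (y : ℝ) : 
    HasDerivAt (fun y => qf A (Function.update g k y)) (2 * ∑ j, A k j * Function.update g k y j) y := by
  have := HasDerivAt.fun_sum (u := Finset.univ) (fun i _ => HasDerivAt.fun_sum (u := Finset.univ) (fun j _ => 
    ((hd_coord g k i y).const_mul (A i j)).fun_mul (hd_coord g k j y)))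
  refine this.congr_deriv ?_
  simp only [Finset.sum_add_distrib, mul_ite, mul_one, mul_zero, ite_mul, zero_mul]
  rw [Finset.sum_comm]
  simp only [Finset.sum_ite_eq', Finset.mem_univ, if_true]
  rw [two_mul]
  congr 1
  exact Finset.sum_congr rfl fun i _ => by rw [hA]

lemma mean_qf (hv : v ≠ 0) (A : D → D → ℝ) : ∫ g, qf A g ∂(gpi D v) = v * ∑ i, A i i := by
  have h1 : ∀ i, ∫ g, g i * (∑ j, A i j * g j) ∂(gpi D v) = v * A i i := by
    intro i
    have := stein_pi hv i (H := fun g => ∑ j, A i j * g j) (H' := fun _ => A i i) 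
      (fun g y => hd_lin (A i) g i y) ((AM.coord i).mul (AM.lin _)).integrable (integrable_const _) (AM.lin _).integrable
    simpa using this
  rw [Finset.mul_sum, ← Finset.sum_congr rfl fun i _ => h1 i, ← integral_finsetSum]
  · congr 1; ext g; unfold qf
    refine Finset.sum_congr rfl fun i _ => ?_
    rw [Finset.mul_sum]; exact Finset.sum_congr rfl fun j _ => by ring
  · intro i _; exact ((AM.coord i).mul (AM.lin _)).integrable

lemma var_qf (hv : v ≠ 0) (A : D → D → ℝ) (hA : ∀ i j, A i j = A j i) : 
    ∫ g, (qf A g - v * ∑ i, A i i)^2 ∂(gpi D v) = 2 * v^2 * ∑ i, ∑ j, A i j ^ 2 := by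
  have h1 : ∀ i, ∫ g, g i * ((∑ j, A i j * g j) * qf A g) ∂(gpi D v) 
      = v * ∫ g, (A i i * qf A g + (∑ j, A i j * g j) * (2 * ∑ j, A i j * g j)) ∂(gpi D v) := by
    intro i
    exact stein_pi hv i (H := fun g => (∑ j, A i j * g j) * qf A g) 
      (H' := fun g => (A i i * qf A g + (∑ j, A i j * g j) * (2 * ∑ j, A i j * g j))) 
      (fun g y => (hd_lin (A i) g i y).fun_mul (hd_qf A hA g i y)) ((AM.coord i).mul ((AM.lin _).mul (AM.qf A))).integrable 
      (((AM.qf A).const_mul _).add ((AM.lin _).mul ((AM.lin _).const_mul _))).integrable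
      ((AM.lin _).mul (AM.qf A)).integrable
  have h2 : ∫ g, qf A g * qf A g ∂(gpi D v) = v * (∑ i, A i i) * (v * ∑ i, A i i) + 2 * v^2 * ∑ i, ∑ j, A i j ^ 2 := by
    have e1 : ∫ g, qf A g * qf A g ∂(gpi D v) = ∑ i, ∫ g, g i * ((∑ j, A i j * g j) * qf A g) ∂(gpi D v) := by
      rw [← integral_finsetSum]
      · congr 1; ext g
        have : ∀ c, qf A g * c = ∑ i, g i * ((∑ j, A i j * g j) * c) := by
          intro c
          rw [qf, Finset.sum_mul]
          refine Finset.sum_congr rfl fun i _ => ?_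
          rw [← mul_assoc, Finset.mul_sum]; congr 1; exact Finset.sum_congr rfl fun j _ => by ring
        exact this _
      · intro i _; exact ((AM.coord i).mul ((AM.lin _).mul (AM.qf A))).integrable
    rw [e1, Finset.sum_congr rfl fun i _ => h1 i]
    have h3 : ∀ i, ∫ g, (A i i * qf A g + (∑ j, A i j * g j) * (2 * ∑ j, A i j * g j)) ∂(gpi D v) = 
        A i i * (v * ∑ i, A i i) + 2 * (v * ∑ j, A i j ^ 2) := by
      intro i
      rw [integral_add ((AM.qf A).const_mul _).integrable ((AM.lin _).mul ((AM.lin _).const_mul _)).integrable, 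
        integral_const_mul, mean_qf hv]
      congr 1
      have := mean_qf (v := v) hv (fun j k => A i j * A i k)
      simp only [← pow_two] at this
      rw [← this, ← integral_const_mul]
      congr 1; ext g
      rw [mul_left_comm]; congr 1
      rw [Finset.sum_mul_sum]; unfold qf
      exact Finset.sum_congr rfl fun j _ => Finset.sum_congr rfl fun k _ => by ring
    rw [Finset.sum_congr rfl fun i _ => by rw [h3 i]]
    simp only [mul_add, Finset.sum_add_distrib, ← Finset.mul_sum, ← Finset.sum_mul]
    ring
  have h4 : ∀ g, (qf A g - v * ∑ i, A i i)^2 = qf A g * qf A g - (2 * (v * ∑ i, A i i)) * qf A g + (v * ∑ i, A i i)^2 := by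
    intro g; ring
  simp_rw [h4]
  rw [integral_add (((AM.qf A).mul (AM.qf A)).sub ((AM.qf A).const_mul _)).integrable (integrable_const _), 
    integral_sub ((AM.qf A).mul (AM.qf A)).integrable ((AM.qf A).const_mul _).integrable, integral_const_mul, 
    mean_qf hv, h2]
  simp
  ring
end mom


lemma cf_lin {D : Type*} [Fintype D] (v : ℝ≥0) (c : D → ℝ) : 
    ∫ g, Complex.exp (((∑ k, c k * g k : ℝ) : ℂ) * Complex.I) ∂(gpi D v) 
      = Complex.exp (-((v * ∑ k, c k ^ 2 : ℝ) : ℂ) / 2) := by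
  have : ∀ g : D → ℝ, Complex.exp (((∑ k, c k * g k : ℝ) : ℂ) * Complex.I) 
     = ∏ k, Complex.exp ((c k : ℂ) * (g k : ℂ) * Complex.I) := by
    intro g
    rw [← Complex.exp_sum]; push_cast; rw [Finset.sum_mul]
  simp_rw [this]
  rw [integral_fintype_prod_eq_prod (𝕜 := ℂ) (fun (k : D) (x : ℝ) => Complex.exp ((c k : ℂ) * (x : ℂ) * Complex.I))]
  simp_rw [← charFun_apply_real, charFun_gaussianReal]
  rw [← Complex.exp_sum]
  congr 1
  push_cast
  rw [Finset.mul_sum, ← Finset.sum_neg_distrib, Finset.sum_div]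
  refine Finset.sum_congr rfl fun k _ => ?_
  simp; ring

lemma meas_linmap {D I : Type*} [Fintype D] [Fintype I] (α : I → D → ℝ) : 
    Measurable (fun (g : D → ℝ) (i : I) => ∑ k, α i k * g k) := by
  refine measurable_pi_iff.2 fun i => ?_
  exact Finset.measurable_sum _ fun k _ => (measurable_pi_apply k).const_mul _

lemma cfd_lin {D I : Type*} [Fintype D] [Fintype I] [DecidableEq I] (v : ℝ≥0) (α : I → D → ℝ) (L : (I → ℝ) →L[ℝ] ℝ) :
     charFunDual ((gpi D v).map (fun g i => ∑ k, α i k * g k)) L = 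
       Complex.exp (-((v * ∑ k, (∑ i, L (Pi.single i 1) * α i k) ^ 2 : ℝ) : ℂ) / 2) := by
  rw [charFunDual_apply, integral_map (meas_linmap α).aemeasurable (by fun_prop), ← cf_lin]
  congr 1; ext g; congr 3
  have := LinearMap.pi_apply_eq_sum_univ L.toLinearMap (fun i => ∑ k, α i k * g k)
  simp only [ContinuousLinearMap.coe_coe] at this
  rw [this]
  have e : ∀ i : I, (fun j => if i = j then (1:ℝ) else 0) = Pi.single i 1 := by
    intro i; ext j; simp [Pi.single_apply, eq_comm]
  simp_rw [e, smul_eq_mul, Finset.sum_mul]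
  rw [Finset.sum_comm]
  exact Finset.sum_congr rfl fun k _ => Finset.sum_congr rfl fun i _ => by ring

lemma sq_lin {D I : Type*} [Fintype D] [Fintype I] (α : I → D → ℝ) (l : I → ℝ) : 
    ∑ k, (∑ i, l i * α i k) ^ 2 = ∑ i, ∑ j, l i * l j * ∑ k, α i k * α j k := by
  simp_rw [pow_two, Finset.sum_mul_sum, Finset.mul_sum]
  rw [Finset.sum_comm]
  refine Finset.sum_congr rfl fun i _ => ?_
  rw [Finset.sum_comm]
  refine Finset.sum_congr rfl fun j _ => Finset.sum_congr rfl fun k _ => by ring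

lemma law_eq {D1 D2 I : Type*} [Fintype D1] [Fintype D2] [Fintype I] (v : ℝ≥0) 
    (α : I → D1 → ℝ) (β : I → D2 → ℝ) (h : ∀ i j, ∑ k, α i k * α j k = ∑ k, β i k * β j k) : 
    (gpi D1 v).map (fun g i => ∑ k, α i k * g k) = (gpi D2 v).map (fun g i => ∑ k, β i k * g k) := by
  classical
  have := Measure.isProbabilityMeasure_map (μ := gpi D1 v) (meas_linmap α).aemeasurable
  have := Measure.isProbabilityMeasure_map (μ := gpi D2 v) (meas_linmap β).aemeasurable
  refine Measure.ext_of_charFunDual ?_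
  ext L
  rw [cfd_lin, cfd_lin, sq_lin, sq_lin]
  simp_rw [h]

lemma mp_curry (A B : Type*) [Fintype A] [Fintype B] (v : ℝ≥0) : 
    MeasurePreserving (fun (g : A × B → ℝ) (i : A) (j : B) => g (i, j)) (gpi (A × B) v) 
      (Measure.pi fun _ : A => gpi B v) := by
  have m1 : Measurable (fun (g : A × B → ℝ) (i : A) (j : B) => g (i, j)) := by fun_prop
  have m2 : Measurable (fun (z : A → B → ℝ) (q : A × B) => z q.1 q.2) := by fun_prop
  have h : gpi (A × B) v = (Measure.pi fun _ : A => gpi B v).map (fun (z : A → B → ℝ) (q : A × B) => z q.1 q.2) := by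
    refine Measure.pi_eq fun s hs => ?_
    rw [Measure.map_apply m2 (MeasurableSet.univ_pi hs)]
    have : (fun (z : A → B → ℝ) (q : A × B) => z q.1 q.2) ⁻¹' (Set.univ.pi s) = 
        Set.univ.pi fun i => Set.univ.pi fun j => s (i, j) := by
      ext z; simp
    rw [this, Measure.pi_pi]
    simp_rw [gpi, Measure.pi_pi]
    rw [← Fintype.prod_prod_type']
  refine ⟨m1, ?_⟩
  rw [h, Measure.map_map m1 m2]
  exact Measure.map_id

/-- flat index type. -/
abbrev D0 (n p : ℕ) := Fin n ⊕ (Fin n × Fin p)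

lemma mp_flat (n p : ℕ) : MeasurePreserving (fun g : D0 n p → ℝ => 
    ((fun i => g (.inl i), fun i j => g (.inr (i, j))) : (Fin n → ℝ) × (Fin n → Fin p → ℝ))) 
    (gpi (D0 n p) (n : ℝ≥0)⁻¹) (spikedLaw n p) := by
  have h1 := measurePreserving_sumPiEquivProdPi (fun _ : D0 n p => gaussianReal 0 (n : ℝ≥0)⁻¹)
  have h2 := (MeasurePreserving.id (gpi (Fin n) (n : ℝ≥0)⁻¹)).prod (mp_curry (Fin n) (Fin p) (n : ℝ≥0)⁻¹)
  exact h2.comp h1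


section slep
variable {D : Type*} [Fintype D] {I : Type*} [Fintype I] [DecidableEq I] 

/-- linear form. -/
def lf (a g : D → ℝ) : ℝ := ∑ k, a k * g k

lemma cont_lf (a : D → ℝ) : Continuous (lf a) := by unfold lf; fun_prop

variable [DecidableEq D]

lemma hd_lf (a : D → ℝ) (g : D → ℝ) (k : D) (y : ℝ) : 
    HasDerivAt (fun y => lf a (Function.update g k y)) (a k) y := hd_lin a g k y

structure SlepHyp (f f' f'' : I → ℝ → ℝ) (B : ℝ) : Prop where
  d1 : ∀ i x, HasDerivAt (f i) (f' i x) x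
  d2 : ∀ i x, HasDerivAt (f' i) (f'' i x) x
  c2 : ∀ i, Continuous (f'' i)
  nn : ∀ i x, 0 ≤ f i x
  le1 : ∀ i x, f i x ≤ 1
  np : ∀ i x, f' i x ≤ 0
  b1 : ∀ i x, |f' i x| ≤ B
  b2 : ∀ i x, |f'' i x| ≤ B

variable {f f' f'' : I → ℝ → ℝ} {B : ℝ}

lemma SlepHyp.c0 (h : SlepHyp f f' f'' B) (i : I) : Continuous (f i) := 
  continuous_iff_continuousAt.2 fun x => (h.d1 i x).continuousAt
lemma SlepHyp.c1 (h : SlepHyp f f' f'' B) (i : I) : Continuous (f' i) := 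
  continuous_iff_continuousAt.2 fun x => (h.d2 i x).continuousAt

lemma SlepHyp.prod_abs (h : SlepHyp f f' f'' B) (s : Finset I) (x : I → ℝ) : |∏ i ∈ s, f i (x i)| ≤ 1 := by
  rw [abs_of_nonneg (Finset.prod_nonneg fun i _ => h.nn i _)]
  exact Finset.prod_le_one (fun i _ => h.nn i _) fun i _ => h.le1 i _

/-- Stein step. -/
lemma slep_stein (h : SlepHyp f f' f'' B) {v : ℝ≥0} (hv : v ≠ 0) (c d : I → D → ℝ) 
    (hcd : ∀ i, ∑ k, d i k * c i k = 0) (hcd' : ∀ i j, i ≠ j → ∑ k, d i k * c j k ≤ 0) : 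
    ∫ g, ∑ i, (∏ j ∈ Finset.univ.erase i, f j (lf (c j) g)) * (f' i (lf (c i) g) * lf (d i) g) ∂(gpi D v) ≤ 0 := by
  rcases isEmpty_or_nonempty I with hI | ⟨⟨i0⟩⟩
  · simp
  have hB : 0 ≤ B := (abs_nonneg _).trans (h.b1 i0 0)
  let H : I → (D → ℝ) → ℝ := fun i g => (∏ j ∈ Finset.univ.erase i, f j (lf (c j) g)) * f' i (lf (c i) g)
  let H1 : I → (D → ℝ) → ℝ := fun i g => (∏ j ∈ Finset.univ.erase i, f j (lf (c j) g)) * f'' i (lf (c i) g)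
  let H2 : I → I → (D → ℝ) → ℝ := fun i j g => (∏ l ∈ (Finset.univ.erase i).erase j, f l (lf (c l) g)) * 
    f' j (lf (c j) g) * f' i (lf (c i) g)
  let H' : I → D → (D → ℝ) → ℝ := fun i k g => (∑ j ∈ Finset.univ.erase i, c j k * H2 i j g) + c i k * H1 i g
  have cl : ∀ i, Continuous fun g => lf (c i) g := fun i => cont_lf _
  have cf : ∀ i, Continuous fun g => f i (lf (c i) g) := fun i => (h.c0 i).comp (cl i)
  have cf1 : ∀ i, Continuous fun g => f' i (lf (c i) g) := fun i => (h.c1 i).comp (cl i)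
  have cf2 : ∀ i, Continuous fun g => f'' i (lf (c i) g) := fun i => (h.c2 i).comp (cl i)
  have bH : ∀ i g, |H i g| ≤ B := by
    intro i g
    simp only [H, abs_mul]
    calc _ ≤ 1 * B := mul_le_mul (h.prod_abs _ _) (h.b1 _ _) (abs_nonneg _) zero_le_one
      _ = B := one_mul _
  have bH1 : ∀ i g, |H1 i g| ≤ B := by
    intro i g
    simp only [H1, abs_mul]
    calc _ ≤ 1 * B := mul_le_mul (h.prod_abs _ _) (h.b2 _ _) (abs_nonneg _) zero_le_one
      _ = B := one_mul _
  have bH2 : ∀ i j g, |H2 i j g| ≤ 1 * B * B := by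
    intro i j g
    simp only [H2, abs_mul]
    exact mul_le_mul (mul_le_mul (h.prod_abs _ _) (h.b1 _ _) (abs_nonneg _) zero_le_one) (h.b1 _ _) (abs_nonneg _) (by positivity)
  have cH : ∀ i, Continuous (H i) := fun i => (continuous_finsetProd _ fun j _ => cf j).mul (cf1 i)
  have cH1 : ∀ i, Continuous (H1 i) := fun i => (continuous_finsetProd _ fun j _ => cf j).mul (cf2 i)
  have cH2 : ∀ i j, Continuous (H2 i j) := fun i j => ((continuous_finsetProd _ fun j _ => cf j).mul (cf1 j)).mul (cf1 i)
  have iH : ∀ i, Integrable (H i) (gpi D v) := fun i => 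
    Integrable.of_bound (cH i).measurable.aestronglyMeasurable B (Eventually.of_forall fun g => bH i g)
  have iH1 : ∀ i, Integrable (H1 i) (gpi D v) := fun i => 
    Integrable.of_bound (cH1 i).measurable.aestronglyMeasurable B (Eventually.of_forall fun g => bH1 i g)
  have iH2 : ∀ i j, Integrable (H2 i j) (gpi D v) := fun i j => 
    Integrable.of_bound (cH2 i j).measurable.aestronglyMeasurable _ (Eventually.of_forall fun g => bH2 i j g)
  have iH' : ∀ i k, Integrable (H' i k) (gpi D v) := fun i k => 
    (integrable_finsetSum _ fun j _ => (iH2 i j).const_mul _).add ((iH1 i).const_mul _)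
  have ik : ∀ i k, Integrable (fun g => g k * H i g) (gpi D v) := fun i k =>
    (AM.coord k).integrable.mul_bdd (cH i).measurable.aestronglyMeasurable (Eventually.of_forall fun g => bH i g)
  have st : ∀ i k, ∫ g, g k * H i g ∂(gpi D v) = v * ∫ g, H' i k g ∂(gpi D v) := by
    intro i k
    refine stein_pi hv k ?_ (ik i k) (iH' i k) (iH i)
    intro g y
    have e1 := HasDerivAt.fun_finsetProd (u := Finset.univ.erase i) (fun j _ => 
      HasDerivAt.comp y (h.d1 j (lf (c j) (Function.update g k y))) (hd_lf (c j) g k y))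
    have e2 := HasDerivAt.comp y (h.d2 i (lf (c i) (Function.update g k y))) (hd_lf (c i) g k y)
    refine (e1.fun_mul e2).congr_deriv ?_
    simp only [H', H2, H1, Function.comp, smul_eq_mul, Finset.sum_mul]
    congr 1
    · exact Finset.sum_congr rfl fun j _ => by ring
    · ring
  have e3 : ∀ g, ∑ i, (∏ j ∈ Finset.univ.erase i, f j (lf (c j) g)) * (f' i (lf (c i) g) * lf (d i) g) 
      = ∑ i, ∑ k, d i k * (g k * H i g) := by
    intro g
    refine Finset.sum_congr rfl fun i _ => ?_
    simp only [lf, H, Finset.mul_sum]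
    exact Finset.sum_congr rfl fun j _ => by ring
  simp_rw [e3]
  rw [integral_finsetSum _ fun i _ => integrable_finsetSum _ fun k _ => (ik i k).const_mul _]
  refine Finset.sum_nonpos fun i _ => ?_
  rw [integral_finsetSum _ fun k _ => (ik i k).const_mul _]
  simp_rw [integral_const_mul, st, H']
  have e4 : ∀ k, ∫ g, (∑ j ∈ Finset.univ.erase i, c j k * H2 i j g) + c i k * H1 i g ∂(gpi D v) 
     = (∑ j ∈ Finset.univ.erase i, c j k * ∫ g, H2 i j g ∂(gpi D v)) + c i k * ∫ g, H1 i g ∂(gpi D v) := by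
    intro k
    rw [integral_add (integrable_finsetSum _ fun j _ => (iH2 i j).const_mul _) ((iH1 i).const_mul _), 
      integral_finsetSum _ fun j _ => (iH2 i j).const_mul _]
    simp_rw [integral_const_mul]
  simp_rw [e4]
  have e5 : ∑ k, d i k * (v * ((∑ j ∈ Finset.univ.erase i, c j k * ∫ g, H2 i j g ∂(gpi D v)) + c i k * ∫ g, H1 i g ∂(gpi D v)))
    = v * (∑ j ∈ Finset.univ.erase i, (∑ k, d i k * c j k) * ∫ g, H2 i j g ∂(gpi D v)) + 
      v * ((∑ k, d i k * c i k) * ∫ g, H1 i g ∂(gpi D v)) := by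
    simp_rw [Finset.sum_mul]
    rw [Finset.sum_comm, ← mul_add, ← Finset.sum_add_distrib, Finset.mul_sum]
    refine Finset.sum_congr rfl fun k _ => ?_
    rw [mul_left_comm, mul_add, Finset.mul_sum]
    congr 2
    · exact Finset.sum_congr rfl fun j _ => by ring
    · ring
  rw [e5, hcd, zero_mul, mul_zero, add_zero]
  refine mul_nonpos_of_nonneg_of_nonpos v.2 (Finset.sum_nonpos fun j hj => ?_)
  refine mul_nonpos_of_nonpos_of_nonneg (hcd' i j (Finset.ne_of_mem_erase hj).symm) (integral_nonneg fun g => ?_)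
  simp only [H2]
  rw [mul_assoc]
  exact mul_nonneg (Finset.prod_nonneg fun i _ => h.nn i _) (mul_nonneg_of_nonpos_of_nonpos (h.np _ _) (h.np _ _))

lemma slepian (h : SlepHyp f f' f'' B) {v : ℝ≥0} (hv : v ≠ 0) (α β : I → D → ℝ) 
    (h0 : ∀ i j, ∑ k, α i k * β j k = 0) (h1 : ∀ i, ∑ k, α i k * α i k = ∑ k, β i k * β i k) 
    (h2 : ∀ i j, ∑ k, β i k * β j k ≤ ∑ k, α i k * α j k) : 
    ∫ g, ∏ i, f i (lf (β i) g) ∂(gpi D v) ≤ ∫ g, ∏ i, f i (lf (α i) g) ∂(gpi D v) := by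
  rcases isEmpty_or_nonempty I with hI | ⟨⟨i0⟩⟩
  · simp
  have hB : 0 ≤ B := (abs_nonneg _).trans (h.b1 i0 0)
  let c : ℝ → I → D → ℝ := fun t i k => Real.cos t * α i k + Real.sin t * β i k
  let d : ℝ → I → D → ℝ := fun t i k => -Real.sin t * α i k + Real.cos t * β i k
  have cl : ∀ t i, Continuous fun g => lf (c t i) g := fun t i => cont_lf _
  have cf : ∀ t i, Continuous fun g => f i (lf (c t i) g) := fun t i => (h.c0 i).comp (cl t i)
  have cf1 : ∀ t i, Continuous fun g => f' i (lf (c t i) g) := fun t i => (h.c1 i).comp (cl t i)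
  have hdl : ∀ i g t, HasDerivAt (fun t => lf (c t i) g) (lf (d t i) g) t := by
    intro i g t
    exact HasDerivAt.fun_sum (u := Finset.univ) (fun k _ => 
      ((((Real.hasDerivAt_cos t).mul_const (α i k)).fun_add ((Real.hasDerivAt_sin t).mul_const (β i k))).mul_const (g k)))
  let F : ℝ → (D → ℝ) → ℝ := fun t g => ∏ i, f i (lf (c t i) g)
  let F' : ℝ → (D → ℝ) → ℝ := fun t g => ∑ i, (∏ j ∈ Finset.univ.erase i, f j (lf (c t j) g)) * (f' i (lf (c t i) g) * lf (d t i) g)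
  have hF : ∀ g t, HasDerivAt (fun t => F t g) (F' t g) t := by
    intro g t
    exact HasDerivAt.fun_finsetProd (u := Finset.univ) (fun i _ => 
      HasDerivAt.comp t (h.d1 i (lf (c t i) g)) (hdl i g t))
  have cF : ∀ t, Continuous (F t) := fun t => continuous_finsetProd _ fun j _ => cf t j
  have cF' : ∀ t, Continuous (F' t) := fun t => continuous_finsetSum _ fun i _ => 
    (continuous_finsetProd _ fun j _ => cf t j).mul ((cf1 t i).mul (cont_lf _))
  let bd : (D → ℝ) → ℝ := fun g => ∑ i, B * ∑ k, (|α i k| + |β i k|) * |g k|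
  have ibd : Integrable bd (gpi D v) := integrable_finsetSum _ fun i _ => 
    (integrable_finsetSum _ fun k _ => ((AM.coord k).integrable.abs.const_mul _)).const_mul _
  have hbd : ∀ t g, |F' t g| ≤ bd g := by
    intro t g
    refine (Finset.abs_sum_le_sum_abs _ _).trans (Finset.sum_le_sum fun i _ => ?_)
    rw [abs_mul, abs_mul, ← one_mul (B * _)]
    refine mul_le_mul (h.prod_abs _ _) (mul_le_mul (h.b1 _ _) ?_ (abs_nonneg _) hB) (by positivity) zero_le_one
    refine (Finset.abs_sum_le_sum_abs _ _).trans (Finset.sum_le_sum fun k _ => ?_)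
    rw [abs_mul]
    refine mul_le_mul_of_nonneg_right ?_ (abs_nonneg _)
    refine (abs_add_le _ _).trans (add_le_add ?_ ?_)
    · rw [abs_mul, abs_neg]
      exact mul_le_of_le_one_left (abs_nonneg _) (Real.abs_sin_le_one t)
    · rw [abs_mul]
      exact mul_le_of_le_one_left (abs_nonneg _) (Real.abs_cos_le_one t)
  have iF : ∀ t, Integrable (F t) (gpi D v) := fun t => 
    Integrable.of_bound (cF t).measurable.aestronglyMeasurable 1 (Eventually.of_forall fun g => h.prod_abs _ _)
  have key : ∀ t, HasDerivAt (fun t => ∫ g, F t g ∂(gpi D v)) (∫ g, F' t g ∂(gpi D v)) t := by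
    intro t
    exact (hasDerivAt_integral_of_dominated_loc_of_deriv_le (s := Set.univ) Filter.univ_mem 
      (Eventually.of_forall fun t => (cF t).measurable.aestronglyMeasurable) (iF t) (cF' t).measurable.aestronglyMeasurable
      (Eventually.of_forall fun g t _ => hbd t g) ibd (Eventually.of_forall fun g t _ => hF g t)).2
  have exp : ∀ t i j, ∑ k, d t i k * c t j k = Real.sin t * Real.cos t * (∑ k, β i k * β j k - ∑ k, α i k * α j k) := by
    intro t i j
    have : ∀ k, d t i k * c t j k = Real.sin t * Real.cos t * (β i k * β j k) - Real.sin t * Real.cos t * (α i k * α j k) 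
       + (- (Real.sin t)^2 * (α i k * β j k) + (Real.cos t)^2 * (α j k * β i k)) := by
      intro k; simp only [c, d]; ring
    simp_rw [this, Finset.sum_add_distrib, Finset.sum_sub_distrib, ← Finset.mul_sum, h0]
    ring
  have anti : AntitoneOn (fun t => ∫ g, F t g ∂(gpi D v)) (Set.Icc 0 (Real.pi/2)) := by
    refine antitoneOn_of_deriv_nonpos (convex_Icc _ _) (fun t _ => (key t).continuousAt.continuousWithinAt) 
      (fun t _ => (key t).differentiableAt.differentiableWithinAt) fun t ht => ?_
    rw [interior_Icc] at ht
    rw [(key t).deriv]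
    refine slep_stein h hv (c t) (d t) (fun i => ?_) (fun i j _ => ?_)
    · rw [exp, h1, sub_self, mul_zero]
    · rw [exp]
      refine mul_nonpos_of_nonneg_of_nonpos (mul_nonneg ?_ ?_) (sub_nonpos.2 (h2 i j))
      · exact Real.sin_nonneg_of_nonneg_of_le_pi ht.1.le (by linarith [ht.2, Real.pi_pos])
      · exact Real.cos_nonneg_of_neg_pi_div_two_le_of_le (by linarith [ht.1, Real.pi_pos]) ht.2.le
  have := anti (Set.left_mem_Icc.2 (by positivity)) (Set.right_mem_Icc.2 (by positivity)) (by positivity)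
  simpa [F, c] using this
end slep


section slep2
variable {D : Type*} [Fintype D] [DecidableEq D]

lemma sig_hyp {I : Type*} (a : I → ℝ) {b : ℝ} (hb : 0 < b) : 
    SlepHyp (fun i x => Real.sigmoid (b * (a i - x))) 
      (fun i x => Real.sigmoid (b * (a i - x)) * (1 - Real.sigmoid (b * (a i - x))) * (-b))
      (fun i x => Real.sigmoid (b * (a i - x)) * (1 - Real.sigmoid (b * (a i - x))) * (1 - 2 * Real.sigmoid (b * (a i - x))) * b^2) (b + b^2) := by
  have hs : ∀ i x, HasDerivAt (fun x => Real.sigmoid (b * (a i - x))) 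
      (Real.sigmoid (b * (a i - x)) * (1 - Real.sigmoid (b * (a i - x))) * (-b)) x := by
    intro i x
    have h1 : HasDerivAt (fun x => b * (a i - x)) (-b) x := by
      have := ((hasDerivAt_id' x).const_sub (a i)).const_mul b
      simpa using this
    exact HasDerivAt.comp (h₂ := Real.sigmoid) (h := fun x => b * (a i - x)) x (Real.hasDerivAt_sigmoid (b * (a i - x))) h1
  have c : ∀ i, Continuous fun x => Real.sigmoid (b * (a i - x)) := fun i => 
    continuous_iff_continuousAt.2 fun x => (hs i x).continuousAt
  have p := fun i x => Real.sigmoid_pos (b * (a i - x))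
  have q := fun i x => Real.sigmoid_lt_one (b * (a i - x))
  refine ⟨hs, fun i x => ?_, fun i => ?_, fun i x => (p i x).le, fun i x => (q i x).le, fun i x => ?_, fun i x => ?_, fun i x => ?_⟩
  · have := ((hs i x).fun_mul ((hs i x).const_sub 1)).mul_const (-b)
    refine this.congr_deriv ?_
    ring
  · have := c i
    fun_prop
  · have := p i x; have := q i x
    have := mul_pos (mul_pos (p i x) (sub_pos.2 (q i x))) hb
    linarith
  · have h1 := p i x; have h2 := q i x
    generalize Real.sigmoid (b * (a i - x)) = s at *
    have : |s * (1 - s)| ≤ 1 := by rw [abs_le]; constructor <;> nlinarith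
    rw [abs_mul, abs_neg, abs_of_pos hb]
    nlinarith [sq_nonneg b]
  · have h1 := p i x; have h2 := q i x
    generalize Real.sigmoid (b * (a i - x)) = s at *
    have h3 : |s * (1 - s)| ≤ 1 := by rw [abs_le]; constructor <;> nlinarith
    have h4 : |1 - 2 * s| ≤ 1 := by rw [abs_le]; constructor <;> linarith
    rw [abs_mul, abs_mul, abs_of_nonneg (sq_nonneg b)]
    have := mul_le_one₀ h3 (abs_nonneg _) h4
    nlinarith [sq_nonneg b]

lemma one_sub_prod_le {I : Type*} [DecidableEq I] (s : Finset I) (f : I → ℝ) (h0 : ∀ i, 0 ≤ f i) (h1 : ∀ i, f i ≤ 1) : 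
    1 - ∏ i ∈ s, f i ≤ ∑ i ∈ s, (1 - f i) := by
  induction s using Finset.induction_on with
  | empty => simp
  | insert i s hi ih =>
    rw [Finset.prod_insert hi, Finset.sum_insert hi]
    have a1 : ∏ i ∈ s, f i ≤ 1 := Finset.prod_le_one (fun i _ => h0 i) fun i _ => h1 i
    nlinarith [h0 i, h1 i]

lemma slep_fin {I : Type*} [Fintype I] [DecidableEq I] {v : ℝ≥0} (hv : v ≠ 0) (α β : I → D → ℝ) 
    (h0 : ∀ i j, ∑ k, α i k * β j k = 0) (h1 : ∀ i, ∑ k, α i k * α i k = ∑ k, β i k * β i k) 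
    (h2 : ∀ i j, ∑ k, β i k * β j k ≤ ∑ k, α i k * α j k) (a : I → ℝ) {ε : ℝ} (hε : 0 < ε) : 
    (gpi D v).real {g | ∃ i, a i ≤ lf (α i) g} ≤ 2 * (gpi D v).real {g | ∃ i, a i - ε < lf (β i) g} := by
  set μ := gpi D v
  refine le_of_forall_pos_le_add fun η hη => ?_
  obtain ⟨b, hb, hbη⟩ : ∃ b : ℝ, 0 < b ∧ (Fintype.card I : ℝ) * (1 - Real.sigmoid (b * ε)) < η / 2 := by
    have t1 : Tendsto (fun b : ℝ => (Fintype.card I : ℝ) * (1 - Real.sigmoid (b * ε))) atTop (nhds 0) := by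
      have := (tendsto_const_nhds (x := (1:ℝ))).sub (Real.tendsto_sigmoid_atTop.comp (tendsto_id.atTop_mul_const hε))
      simpa using this.const_mul (Fintype.card I : ℝ)
    exact ((eventually_gt_atTop 0).and (t1.eventually (gt_mem_nhds (half_pos hη)))).exists
  have H := sig_hyp a hb
  have S := slepian H hv α β h0 h1 h2
  set f : I → ℝ → ℝ := fun i x => Real.sigmoid (b * (a i - x))
  have cf : ∀ γ : I → D → ℝ, Continuous fun g => ∏ i, f i (lf (γ i) g) := fun γ => 
    continuous_finsetProd _ fun i _ => (H.c0 i).comp (cont_lf _)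
  have iF : ∀ γ : I → D → ℝ, Integrable (fun g => ∏ i, f i (lf (γ i) g)) μ := fun γ => 
    Integrable.of_bound (cf γ).measurable.aestronglyMeasurable 1 (Eventually.of_forall fun g => H.prod_abs _ _)
  have mA : MeasurableSet {g | ∃ i, a i ≤ lf (α i) g} := by
    simp only [Set.ofPred_exists]
    exact MeasurableSet.iUnion fun i => measurableSet_le measurable_const (cont_lf _).measurable
  have mB : MeasurableSet {g | ∃ i, a i - ε < lf (β i) g} := by
    simp only [Set.ofPred_exists]
    exact MeasurableSet.iUnion fun i => measurableSet_lt measurable_const (cont_lf _).measurable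
  have i1 : μ.real {g | ∃ i, a i ≤ lf (α i) g} * (1/2) ≤ ∫ g, (1 - ∏ i, f i (lf (α i) g)) ∂μ := by
    rw [← smul_eq_mul, ← integral_indicator_const _ mA]
    refine integral_mono ((integrable_const _).indicator mA) ((integrable_const _).sub (iF α)) fun g => ?_
    have p0 : ∏ i, f i (lf (α i) g) ≤ 1 := Finset.prod_le_one (fun i _ => H.nn i _) fun i _ => H.le1 i _
    by_cases hg : g ∈ {g | ∃ i, a i ≤ lf (α i) g}
    · rw [Set.indicator_of_mem hg]
      obtain ⟨i, hi⟩ := hg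
      have : f i (lf (α i) g) ≤ 1/2 := by
        have := Real.sigmoid_le (a := b * (a i - lf (α i) g)) (b := 0) (by nlinarith)
        rw [Real.sigmoid_zero] at this
        simpa using this
      have p2 : ∏ j ∈ Finset.univ.erase i, f j (lf (α j) g) ≤ 1 := Finset.prod_le_one (fun i _ => H.nn i _) fun i _ => H.le1 i _
      have p3 : 0 ≤ ∏ j ∈ Finset.univ.erase i, f j (lf (α j) g) := Finset.prod_nonneg (fun i _ => H.nn i _)
      simp only
      rw [← Finset.mul_prod_erase _ _ (Finset.mem_univ i)]
      have := H.nn i (lf (α i) g)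
      nlinarith
    · rw [Set.indicator_of_notMem hg]; simpa using p0
  have i2 : ∫ g, (1 - ∏ i, f i (lf (β i) g)) ∂μ ≤ μ.real {g | ∃ i, a i - ε < lf (β i) g} + η/2 := by
    have : ∫ g, ({g | ∃ i, a i - ε < lf (β i) g}.indicator (fun _ => (1:ℝ)) g + η/2) ∂μ 
       = μ.real {g | ∃ i, a i - ε < lf (β i) g} + η/2 := by
      rw [integral_add ((integrable_const _).indicator mB) (integrable_const _), integral_indicator_const _ mB]
      simp
    rw [← this]
    refine integral_mono ((integrable_const _).sub (iF β)) (((integrable_const _).indicator mB).add (integrable_const _)) fun g => ?_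
    have p3 : 0 ≤ ∏ j, f j (lf (β j) g) := Finset.prod_nonneg (fun i _ => H.nn i _)
    by_cases hg : g ∈ {g | ∃ i, a i - ε < lf (β i) g}
    · simp only
      rw [Set.indicator_of_mem hg]; linarith
    · simp only
      rw [Set.indicator_of_notMem hg]
      simp only [Set.mem_ofPred_eq, not_exists, not_lt] at hg
      have q1 := one_sub_prod_le Finset.univ (fun i => f i (lf (β i) g)) (fun i => H.nn i _) fun i => H.le1 i _
      have q2 : ∑ i, (1 - f i (lf (β i) g)) ≤ ∑ i : I, (1 - Real.sigmoid (b * ε)) := by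
        refine Finset.sum_le_sum fun i _ => ?_
        have := Real.sigmoid_le (a := b * ε) (b := b * (a i - lf (β i) g)) (by nlinarith [hg i])
        simp only [f]; linarith
      rw [Finset.sum_const, Finset.card_univ, nsmul_eq_mul] at q2
      linarith
  have i3 : ∫ g, (1 - ∏ i, f i (lf (α i) g)) ∂μ ≤ ∫ g, (1 - ∏ i, f i (lf (β i) g)) ∂μ := by
    rw [integral_sub (integrable_const _) (iF α), integral_sub (integrable_const _) (iF β)]
    linarith
  linarith

lemma slep_nat {v : ℝ≥0} (hv : v ≠ 0) (α β : ℕ → D → ℝ) 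
    (h0 : ∀ i j, ∑ k, α i k * β j k = 0) (h1 : ∀ i, ∑ k, α i k * α i k = ∑ k, β i k * β i k) 
    (h2 : ∀ i j, ∑ k, β i k * β j k ≤ ∑ k, α i k * α j k) (a : ℕ → ℝ) {ε : ℝ} (hε : 0 < ε) : 
    (gpi D v).real {g | ∃ i, a i ≤ lf (α i) g} ≤ 2 * (gpi D v).real {g | ∃ i, a i - ε < lf (β i) g} := by
  set μ := gpi D v
  have e : {g | ∃ i, a i ≤ lf (α i) g} = ⋃ N : ℕ, {g | ∃ i : Fin N, a i ≤ lf (α i) g} := by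
    ext g
    simp only [Set.mem_ofPred_eq, Set.mem_iUnion]
    constructor
    · rintro ⟨i, hi⟩; exact ⟨i+1, ⟨i, by simp⟩, hi⟩
    · rintro ⟨N, i, hi⟩; exact ⟨i, hi⟩
  have mono : Monotone fun N : ℕ => {g : D → ℝ | ∃ i : Fin N, a i ≤ lf (α i) g} := by
    intro N M hNM g
    rintro ⟨i, hi⟩
    exact ⟨Fin.castLE hNM i, hi⟩
  have t := tendsto_measure_iUnion_atTop (μ := μ) mono
  rw [← e] at t
  have t2 := (ENNReal.tendsto_toReal (measure_ne_top _ _)).comp t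
  refine le_of_tendsto' t2 fun N => ?_
  have := slep_fin hv (fun i : Fin N => α i) (fun i : Fin N => β i) (fun i j => h0 i j) (fun i => h1 i) (fun i j => h2 i j) (fun i => a i) hε
  refine this.trans ?_
  have : μ.real {g | ∃ i : Fin N, a i - ε < lf (β i) g} ≤ μ.real {g | ∃ i, a i - ε < lf (β i) g} := 
    measureReal_mono (fun g ⟨i, hi⟩ => ⟨i, hi⟩)
  linarith
end slep2


lemma cheb {Ω : Type*} [MeasurableSpace Ω] {μ : Measure Ω} [IsFiniteMeasure μ] {f : Ω → ℝ} (hf : AM μ f) {η : ℝ} (hη : 0 < η) :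
    μ.real {x | η ≤ |f x|} ≤ (∫ x, f x ^ 2 ∂μ) / η^2 := by
  have h := mul_meas_ge_le_integral_of_nonneg (μ := μ) (f := fun x => f x ^ 2) (Eventually.of_forall fun x => sq_nonneg _) 
    ((hf.mul hf).congr (fun x => by ring)).integrable (η^2)
  have e : {x | η ≤ |f x|} = {x | η^2 ≤ f x ^ 2} := by
    ext x
    simp only [Set.mem_ofPred_eq]
    rw [sq_le_sq, abs_of_pos hη]
  rw [e, le_div_iff₀ (by positivity), mul_comm]
  exact h

lemma cheb_lf {D : Type*} [Fintype D] [DecidableEq D] {v : ℝ≥0} (hv : v ≠ 0) (w : D → ℝ) {η : ℝ} (hη : 0 < η) : 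
    (gpi D v).real {g | η ≤ |lf w g|} ≤ v * (∑ k, w k ^ 2) / η^2 := by
  refine (cheb (AM.lin w) hη).trans_eq ?_
  have := mean_qf (v := v) hv (fun j k => w j * w k)
  congr 1
  simp_rw [pow_two, ← this]
  congr 1; ext g
  rw [Finset.sum_mul_sum]; unfold qf
  exact Finset.sum_congr rfl fun j _ => Finset.sum_congr rfl fun k _ => by ring

lemma cheb_norm {m : ℕ} {v : ℝ≥0} (hv : v ≠ 0) {η : ℝ} (hη : 0 < η) : 
    (gpi (Fin m) v).real {g | η ≤ |dotp g g - v * m|} ≤ 2 * v^2 * m / η^2 := by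
  have := var_qf (D := Fin m) (v := v) hv (fun j k => if j = k then 1 else 0) (by intro i j; simp [eq_comm])
  have e : ∀ g : Fin m → ℝ, qf (fun j k => if j = k then (1:ℝ) else 0) g = dotp g g := by
    intro g; simp [qf, dotp]
  simp only [e] at this
  simp only [if_true, Finset.sum_const, Finset.card_univ, Fintype.card_fin, nsmul_eq_mul, mul_one, ite_pow, one_pow, ne_eq, OfNat.ofNat_ne_zero, 
    not_false_eq_true, zero_pow, Finset.sum_ite_eq, Finset.mem_univ] at this
  rw [← this]
  refine cheb (AM.sub (AM.congr (AM.qf (fun j k => if j = k then (1:ℝ) else 0)) e) (AM.const _)) hη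

section sums
variable {A B : Type*} [Fintype A] [Fintype B] {v : ℝ≥0}
lemma mp_sum : MeasurePreserving (fun (g : A ⊕ B → ℝ) => ((fun k => g (.inl k), fun k => g (.inr k)) : (A → ℝ) × (B → ℝ))) 
    (gpi (A ⊕ B) v) ((gpi A v).prod (gpi B v)) := 
  measurePreserving_sumPiEquivProdPi (fun _ : A ⊕ B => gaussianReal 0 v)

lemma mp_inl : MeasurePreserving (fun (g : A ⊕ B → ℝ) k => g (.inl k)) (gpi (A ⊕ B) v) (gpi A v) := 
  measurePreserving_fst.comp mp_sum
lemma mp_inr : MeasurePreserving (fun (g : A ⊕ B → ℝ) k => g (.inr k)) (gpi (A ⊕ B) v) (gpi B v) := 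
  measurePreserving_snd.comp mp_sum
end sums

lemma half_pos_gauss (v : ℝ≥0) : 1/2 ≤ (gpi Unit v).real {g | 0 ≤ g ()} := by
  have e : (gpi Unit v).real {g | 0 ≤ g ()} = (gaussianReal 0 v).real (Set.Ici 0) := 
    (measurePreserving_eval (fun _ : Unit => gaussianReal 0 v) ()).measureReal_preimage measurableSet_Ici.nullMeasurableSet
  rw [e]
  have e2 : (gaussianReal 0 v).real (Set.Iic 0) = (gaussianReal 0 v).real (Set.Ici 0) := by
    have h := gaussianReal_map_neg (μ := 0) (v := v)
    rw [neg_zero] at h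
    have : (gaussianReal 0 v).real (Set.Ici 0) = ((gaussianReal 0 v).map (fun x => -x)).real (Set.Ici 0) := by rw [h]
    rw [this, map_measureReal_apply measurable_neg measurableSet_Ici]
    congr 1; ext x; simp
  have e3 : (1:ℝ) ≤ (gaussianReal 0 v).real (Set.Iic 0) + (gaussianReal 0 v).real (Set.Ici 0) := by
    rw [← probReal_univ (μ := gaussianReal 0 v), ← Set.Iic_union_Ici (a := (0:ℝ))]
    exact measureReal_union_le _ _
  linarith

section dot
variable {m : ℕ}
lemma dotp_comm (x y : Fin m → ℝ) : dotp x y = dotp y x := by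
  unfold dotp; exact Finset.sum_congr rfl fun i _ => mul_comm _ _
lemma dotp_self_nonneg (x : Fin m → ℝ) : 0 ≤ dotp x x := Finset.sum_nonneg fun i _ => mul_self_nonneg _
lemma dotp_cs (x y : Fin m → ℝ) : dotp x y ^ 2 ≤ dotp x x * dotp y y := by
  have := Finset.sum_mul_sq_le_sq_mul_sq Finset.univ x y
  simpa [dotp, pow_two] using this
lemma dotp_le (x y : Fin m → ℝ) : dotp x y ≤ √(dotp x x) * √(dotp y y) := by
  rw [← Real.sqrt_mul (dotp_self_nonneg x)]
  exact Real.le_sqrt_of_sq_le (dotp_cs x y)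
lemma dotp_abs_le (x y : Fin m → ℝ) : |dotp x y| ≤ √(dotp x x) * √(dotp y y) := by
  rw [← Real.sqrt_mul (dotp_self_nonneg x)]
  exact Real.abs_le_sqrt (dotp_cs x y)
lemma dotp_add_left (x y z : Fin m → ℝ) : dotp (x + y) z = dotp x z + dotp y z := by
  simp [dotp, add_mul, Finset.sum_add_distrib]
lemma dotp_add_right (x y z : Fin m → ℝ) : dotp z (x + y) = dotp z x + dotp z y := by
  simp [dotp, mul_add, Finset.sum_add_distrib]
lemma dotp_sub_left (x y z : Fin m → ℝ) : dotp (x - y) z = dotp x z - dotp y z := by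
  simp [dotp, sub_mul, Finset.sum_sub_distrib]
lemma dotp_sub_right (x y z : Fin m → ℝ) : dotp z (x - y) = dotp z x - dotp z y := by
  simp [dotp, mul_sub, Finset.sum_sub_distrib]
lemma dotp_smul_left (c : ℝ) (x z : Fin m → ℝ) : dotp (c • x) z = c * dotp x z := by
  simp [dotp, mul_assoc, Finset.mul_sum]
lemma dotp_smul_right (c : ℝ) (x z : Fin m → ℝ) : dotp z (c • x) = c * dotp z x := by
  simp [dotp, mul_left_comm, Finset.mul_sum]
lemma cont_dotp : Continuous fun q : (Fin m → ℝ) × (Fin m → ℝ) => dotp q.1 q.2 := by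
  unfold dotp; fun_prop
lemma dotp_eq_zero {x : Fin m → ℝ} (h : dotp x x = 0) : x = 0 := by
  unfold dotp at h
  rw [Finset.sum_eq_zero_iff_of_nonneg (fun i _ => mul_self_nonneg _)] at h
  ext i; simpa using h i (Finset.mem_univ i)

/-- decomposition along a unit vector. -/
lemma dotp_decomp (w h y : Fin m → ℝ) (hw : dotp w w = 1) (hy : dotp y y = 1) : 
    dotp h y ≤ √(dotp h h) * √(1 - dotp w y ^ 2) + |dotp w h| := by
  have e : dotp h y = dotp h (y - dotp w y • w) + dotp w y * dotp w h := by
    rw [dotp_sub_right, dotp_smul_right, dotp_comm h w]; ring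
  have e2 : dotp (y - dotp w y • w) (y - dotp w y • w) = 1 - dotp w y ^ 2 := by
    simp only [dotp_sub_right, dotp_sub_left, dotp_smul_right, dotp_smul_left, hw, hy, dotp_comm y w]; ring
  have h1 := dotp_le h (y - dotp w y • w)
  rw [e2] at h1
  have h2 : |dotp w y| ≤ 1 := by simpa [hw, hy] using dotp_abs_le w y
  have h3 : dotp w y * dotp w h ≤ |dotp w h| := by
    refine (le_abs_self _).trans ?_
    rw [abs_mul]; exact mul_le_of_le_one_left (abs_nonneg _) h2
  linarith
end dot


/-- pairs of unit vectors. -/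
abbrev SS (n p : ℕ) := {q : (Fin n → ℝ) × (Fin p → ℝ) // dotp q.1 q.1 = 1 ∧ dotp q.2 q.2 = 1}

/-- index of the comparison process -/
abbrev D3 (n p : ℕ) := Fin n ⊕ (Fin p ⊕ Unit)

section U
variable {n p : ℕ} (lam : ℝ) (w : Fin p → ℝ)

/-- norm of extended vector -/
def NN (y : Fin p → ℝ) : ℝ := √(1 + lam^2 * dotp w y ^ 2)

/-- bilinear form. -/
def bil (u : Fin n → ℝ) (Z : Fin n → Fin p → ℝ) (x : Fin n → ℝ) (y : Fin p → ℝ) : ℝ := 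
  dotp x ((spikedMatrix lam w u Z).mulVec y)

/-- comparison form. -/
def cmpf (s : SS n p) (g : D3 n p → ℝ) : ℝ := 
  NN lam w s.1.2 * dotp (fun i => g (.inl i)) s.1.1 + dotp (fun j => g (.inr (.inl j))) s.1.2 + lam * dotp w s.1.2 * g (.inr (.inr ()))

def al (s : SS n p) : ((D0 n p ⊕ Unit) ⊕ D3 n p) → ℝ := 
  Sum.elim (Sum.elim (Sum.elim (fun i => lam * s.1.1 i * dotp w s.1.2) (fun q => s.1.1 q.1 * s.1.2 q.2)) (fun _ => NN lam w s.1.2)) (fun _ => 0)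

def be (s : SS n p) : ((D0 n p ⊕ Unit) ⊕ D3 n p) → ℝ := 
  Sum.elim (fun _ => 0) (Sum.elim (fun i => NN lam w s.1.2 * s.1.1 i) (Sum.elim (fun j => s.1.2 j) (fun _ => lam * dotp w s.1.2)))

lemma lf_al (s : SS n p) (g : ((D0 n p ⊕ Unit) ⊕ D3 n p) → ℝ) : lf (al lam w s) g = 
    bil lam w (fun i => g (.inl (.inl (.inl i)))) (fun i j => g (.inl (.inl (.inr (i, j))))) s.1.1 s.1.2 
     + NN lam w s.1.2 * g (.inl (.inr ())) := by
  simp only [lf, al, bil, dotp, mulVec, dotProduct, spikedMatrix, Matrix.of_apply, Fintype.sum_sum_type, Sum.elim_inl, Sum.elim_inr, 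
    Fintype.sum_prod_type, zero_mul, Finset.sum_const_zero, add_zero, Finset.univ_unique, Finset.sum_singleton]
  congr 1
  rw [← Finset.sum_add_distrib]
  refine Finset.sum_congr rfl fun i _ => ?_
  simp only [add_mul, Finset.sum_add_distrib, mul_add, Finset.mul_sum, Finset.sum_mul]
  congr 1
  · exact Finset.sum_congr rfl fun j _ => by ring
  · exact Finset.sum_congr rfl fun j _ => by ring

lemma lf_be (s : SS n p) (g : ((D0 n p ⊕ Unit) ⊕ D3 n p) → ℝ) : lf (be lam w s) g = cmpf lam w s (fun k => g (.inr k)) := by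
  simp only [lf, be, cmpf, dotp, Fintype.sum_sum_type, Sum.elim_inl, Sum.elim_inr, 
    zero_mul, Finset.sum_const_zero, add_zero, zero_add, Finset.univ_unique, Finset.sum_singleton]
  rw [add_assoc]
  congr 1
  · rw [Finset.mul_sum]
    exact Finset.sum_congr rfl fun j _ => by ring
  · congr 1
    exact Finset.sum_congr rfl fun j _ => by ring

lemma ab_zero (s t : SS n p) : ∑ k, al lam w s k * be lam w t k = 0 := by
  simp [al, be, Fintype.sum_sum_type]

lemma aa (s t : SS n p) : ∑ k, al lam w s k * al lam w t k = 
    dotp s.1.1 t.1.1 * (dotp s.1.2 t.1.2 + lam^2 * (dotp w s.1.2 * dotp w t.1.2)) + NN lam w s.1.2 * NN lam w t.1.2 := by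
  simp only [al, Fintype.sum_sum_type, Sum.elim_inl, Sum.elim_inr, Fintype.sum_prod_type, 
    mul_zero, Finset.sum_const_zero, add_zero, Finset.univ_unique, Finset.sum_singleton]
  congr 1
  rw [mul_add, add_comm]
  congr 1
  · rw [dotp, dotp, Finset.sum_mul_sum]
    exact Finset.sum_congr rfl fun i _ => Finset.sum_congr rfl fun j _ => by ring
  · generalize dotp w s.1.2 = a; generalize dotp w t.1.2 = b
    rw [dotp, Finset.sum_mul]
    exact Finset.sum_congr rfl fun i _ => by ring

lemma bb (s t : SS n p) : ∑ k, be lam w s k * be lam w t k = 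
    dotp s.1.1 t.1.1 * (NN lam w s.1.2 * NN lam w t.1.2) + (dotp s.1.2 t.1.2 + lam^2 * (dotp w s.1.2 * dotp w t.1.2)) := by
  simp only [be, Fintype.sum_sum_type, Sum.elim_inl, Sum.elim_inr, 
    mul_zero, Finset.sum_const_zero, zero_add, Finset.univ_unique, Finset.sum_singleton]
  congr 1
  · rw [dotp, Finset.sum_mul]
    exact Finset.sum_congr rfl fun i _ => by ring
  · congr 1
    ring

lemma NN_mul (y z : Fin p → ℝ) (hy : dotp y y = 1) (hz : dotp z z = 1) : 
    dotp y z + lam^2 * (dotp w y * dotp w z) ≤ NN lam w y * NN lam w z := by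
  have h1 : dotp y z ≤ 1 := by simpa [hy, hz] using dotp_le y z
  rw [NN, NN, ← Real.sqrt_mul (by positivity)]
  refine Real.le_sqrt_of_sq_le ?_
  generalize dotp w y = a at *
  generalize dotp w z = b at *
  have h2 : -1 ≤ dotp y z := by have := dotp_abs_le y z; rw [abs_le] at this; simpa [hy, hz] using this.1
  generalize dotp y z = r at *
  nlinarith [mul_nonneg (sub_nonneg.2 h1) (sq_nonneg (lam * (a + b))), mul_nonneg (by linarith : 0 ≤ 1 + r) (sq_nonneg (lam * (a - b)))]

lemma ab_le (s t : SS n p) : ∑ k, be lam w s k * be lam w t k ≤ ∑ k, al lam w s k * al lam w t k := by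
  rw [aa, bb]
  have h1 : dotp s.1.1 t.1.1 ≤ 1 := by simpa [s.2.1, t.2.1] using dotp_le s.1.1 t.1.1
  have h2 := NN_mul lam w s.1.2 t.1.2 s.2.2 t.2.2
  nlinarith

lemma ab_eq (s : SS n p) : ∑ k, al lam w s k * al lam w s k = ∑ k, be lam w s k * be lam w s k := by
  rw [aa, bb, s.2.1]; ring

lemma cont_al (g : ((D0 n p ⊕ Unit) ⊕ D3 n p) → ℝ) : Continuous fun s : SS n p => lf (al lam w s) g := by
  simp only [lf_al, bil, NN, dotp, mulVec, dotProduct]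
  fun_prop

lemma slep_spiked (hn : n ≠ 0) (thr : SS n p → ℝ) (hthr : Continuous thr) {ε : ℝ} (hε : 0 < ε) : 
    (spikedLaw n p).real {uZ | ∃ s : SS n p, thr s < bil lam w uZ.1 uZ.2 s.1.1 s.1.2} 
      ≤ 4 * (gpi (D3 n p) (n : ℝ≥0)⁻¹).real {g | ∃ s : SS n p, thr s - ε < cmpf lam w s g} := by
  have hv : ((n : ℝ≥0)⁻¹) ≠ 0 := inv_ne_zero (by exact_mod_cast hn)
  set v := (n : ℝ≥0)⁻¹ with hvdef
  rcases isEmpty_or_nonempty (SS n p) with hS | hS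
  · simp
  have S := slep_nat hv (fun i => al lam w (TopologicalSpace.denseSeq (SS n p) i)) (fun i => be lam w (TopologicalSpace.denseSeq (SS n p) i)) 
    (fun i j => ab_zero _ _ _ _) (fun i => ab_eq _ _ _) (fun i j => ab_le _ _ _ _) (fun i => thr (TopologicalSpace.denseSeq (SS n p) i)) hε
  set E0 : Set ((Fin n → ℝ) × (Fin n → Fin p → ℝ)) := {uZ | ∃ s : SS n p, thr s < bil lam w uZ.1 uZ.2 s.1.1 s.1.2}
  set E3 : Set (D3 n p → ℝ) := {g | ∃ s : SS n p, thr s - ε < cmpf lam w s g}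
  have oE0 : IsOpen E0 := by
    simp only [E0, Set.ofPred_exists]
    refine isOpen_iUnion fun s => isOpen_lt continuous_const ?_
    unfold bil spikedMatrix dotp mulVec dotProduct
    simp only [Matrix.of_apply]
    fun_prop
  have oE3 : IsOpen E3 := by
    simp only [E3, Set.ofPred_exists]
    refine isOpen_iUnion fun s => isOpen_lt continuous_const ?_
    unfold cmpf dotp
    fun_prop
  have hR : (gpi ((D0 n p ⊕ Unit) ⊕ D3 n p) v).real {g | ∃ i, thr (TopologicalSpace.denseSeq (SS n p) i) - ε < lf (be lam w (TopologicalSpace.denseSeq (SS n p) i)) g} 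
      ≤ (gpi (D3 n p) v).real E3 := by
    rw [← (mp_inr (A := D0 n p ⊕ Unit) (B := D3 n p) (v := v)).measureReal_preimage oE3.measurableSet.nullMeasurableSet]
    refine measureReal_mono ?_
    rintro g ⟨i, hi⟩
    rw [lf_be] at hi
    exact ⟨_, hi⟩
  have hL : (spikedLaw n p).real E0 * (1/2) ≤ 
    (gpi ((D0 n p ⊕ Unit) ⊕ D3 n p) v).real {g | ∃ i, thr (TopologicalSpace.denseSeq (SS n p) i) ≤ lf (al lam w (TopologicalSpace.denseSeq (SS n p) i)) g} := by
    have m0 : MeasurableSet {g : Unit → ℝ | 0 ≤ g ()} := measurableSet_le measurable_const (measurable_pi_apply _)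
    have mE := (mp_flat n p).measurable oE0.measurableSet
    calc (spikedLaw n p).real E0 * (1/2) ≤ (spikedLaw n p).real E0 * (gpi Unit v).real {g | 0 ≤ g ()} := 
          mul_le_mul_of_nonneg_left (half_pos_gauss v) measureReal_nonneg
      _ = (gpi (D0 n p) v).real ((fun g : D0 n p → ℝ => 
    ((fun i => g (.inl i), fun i j => g (.inr (i, j))) : (Fin n → ℝ) × (Fin n → Fin p → ℝ))) ⁻¹' E0) * (gpi Unit v).real {g | 0 ≤ g ()} := by
          rw [(mp_flat n p).measureReal_preimage oE0.measurableSet.nullMeasurableSet]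
      _ = _ := (measureReal_prod_prod _ _).symm
      _ = _ := ((mp_sum (A := D0 n p) (B := Unit) (v := v)).measureReal_preimage (mE.prod m0).nullMeasurableSet).symm
      _ = _ := ((mp_inl (A := D0 n p ⊕ Unit) (B := D3 n p) (v := v)).measureReal_preimage ((mp_sum (v := v)).measurable (mE.prod m0)).nullMeasurableSet).symm
      _ ≤ _ := by
        refine measureReal_mono ?_
        rintro g ⟨⟨s, hs⟩, hg⟩
        have hs' : thr s < lf (al lam w s) g := by
          rw [lf_al]
          have : 0 ≤ NN lam w s.1.2 * g (.inl (.inr ())) := mul_nonneg (Real.sqrt_nonneg _) hg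
          exact hs.trans_le (le_add_of_nonneg_right this)
        have op : IsOpen {s | thr s < lf (al lam w s) g} := isOpen_lt hthr (cont_al lam w g)
        obtain ⟨i, hi⟩ := (TopologicalSpace.denseRange_denseSeq (SS n p)).exists_mem_open op ⟨s, hs'⟩
        exact ⟨i, le_of_lt hi⟩
  linarith
end U


/-- the limiting profile. -/
def psi (lam δ t : ℝ) : ℝ := √(1 + lam^2 * t) + √δ * √(1 - t)

lemma cmpf_le {n p : ℕ} (lam : ℝ) (hlam : 0 < lam) (w : Fin p → ℝ) (hw : dotp w w = 1) (δ : ℝ) (s : SS n p) (g : D3 n p → ℝ) 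
    {η : ℝ} (hη : 0 < η)
    (h1 : √(dotp (fun i => g (.inl i)) (fun i => g (.inl i))) ≤ 1 + η) 
    (h2 : √(dotp (fun j => g (.inr (.inl j))) (fun j => g (.inr (.inl j)))) ≤ √δ + η) 
    (h3 : |dotp w (fun j => g (.inr (.inl j)))| ≤ η) (h4 : |g (.inr (.inr ()))| ≤ η) : 
    cmpf lam w s g ≤ psi lam δ (dotp w s.1.2 ^ 2) + (2 * lam + 3) * η := by
  unfold cmpf psi
  have hc : |dotp w s.1.2| ≤ 1 := by simpa [hw, s.2.2] using dotp_abs_le w s.1.2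
  have a1 : dotp (fun i => g (.inl i)) s.1.1 ≤ 1 + η := by
    refine (dotp_le _ _).trans ?_
    rw [s.2.1]; simpa using h1
  have hN : NN lam w s.1.2 ≤ 1 + lam := by
    unfold NN
    refine Real.sqrt_le_iff.2 ⟨by positivity, ?_⟩
    have : dotp w s.1.2 ^ 2 ≤ 1 := by rw [← sq_abs]; nlinarith [abs_nonneg (dotp w s.1.2)]
    nlinarith [sq_nonneg lam]
  have hN0 : 0 ≤ NN lam w s.1.2 := Real.sqrt_nonneg _
  have a2 := dotp_decomp w (fun j => g (.inr (.inl j))) s.1.2 hw s.2.2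
  have a3 : lam * dotp w s.1.2 * g (.inr (.inr ())) ≤ lam * η := by
    rw [mul_assoc]
    refine mul_le_mul_of_nonneg_left ?_ hlam.le
    refine (le_abs_self _).trans ?_
    rw [abs_mul]
    exact (mul_le_of_le_one_left (abs_nonneg _) hc).trans h4
  have hq : √(1 - dotp w s.1.2 ^ 2) ≤ 1 := by
    rw [Real.sqrt_le_one]; nlinarith [sq_nonneg (dotp w s.1.2)]
  have hq0 := Real.sqrt_nonneg (1 - dotp w s.1.2 ^ 2)
  have a4 : √(dotp (fun j => g (.inr (.inl j))) (fun j => g (.inr (.inl j)))) * √(1 - dotp w s.1.2 ^ 2) ≤ 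
    √δ * √(1 - dotp w s.1.2 ^ 2) + η := by nlinarith
  have a5 : NN lam w s.1.2 * dotp (fun i => g (.inl i)) s.1.1 ≤ √(1 + lam^2 * dotp w s.1.2 ^ 2) + (1 + lam) * η := by
    change _ ≤ NN lam w s.1.2 + _
    nlinarith
  nlinarith

lemma cmp_prob {n p : ℕ} (hn : n ≠ 0) (lam : ℝ) (hlam : 0 < lam) (w : Fin p → ℝ) (hw : dotp w w = 1) (δ : ℝ) (hδ : 0 ≤ δ) 
    {η : ℝ} (hη : 0 < η) (hpn : (p : ℝ) / n ≤ δ + η^2/2) : 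
    (gpi (D3 n p) (n : ℝ≥0)⁻¹).real {g | ∃ s : SS n p, psi lam δ (dotp w s.1.2 ^ 2) + (2 * lam + 3) * η < cmpf lam w s g} 
      ≤ (2 / η^2 + 8 * (δ + η^2/2) / η^4 + 2 / η^2) / n := by
  have hv : ((n : ℝ≥0)⁻¹) ≠ 0 := inv_ne_zero (by exact_mod_cast hn)
  set v := (n : ℝ≥0)⁻¹ with hvdef
  have hvr : (v : ℝ) = (n : ℝ)⁻¹ := by simp [hvdef]
  have hn0 : (0:ℝ) < n := by exact_mod_cast Nat.pos_of_ne_zero hn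
  let A1 : Set (Fin n → ℝ) := {g | η ≤ |dotp g g - v * n|}
  let A2 : Set (Fin p → ℝ) := {g | η^2/2 ≤ |dotp g g - v * p|}
  let A3 : Set (Fin p → ℝ) := {g | η ≤ |lf w g|}
  let A4 : Set (Unit → ℝ) := {g | η ≤ |lf (fun _ => 1) g|}
  have cd : ∀ m, Continuous fun g : Fin m → ℝ => dotp g g := fun m => by unfold dotp; fun_prop
  have m1 : MeasurableSet A1 := (isClosed_le continuous_const ((cd _).sub continuous_const).abs).measurableSet
  have m2 : MeasurableSet A2 := (isClosed_le continuous_const ((cd _).sub continuous_const).abs).measurableSet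
  have m3 : MeasurableSet A3 := (isClosed_le continuous_const (cont_lf _).abs).measurableSet
  have m4 : MeasurableSet A4 := (isClosed_le continuous_const (cont_lf _).abs).measurableSet
  have b1 : (gpi (D3 n p) v).real ((fun (g : D3 n p → ℝ) k => g (.inl k)) ⁻¹' A1) ≤ 2 * v^2 * n / η^2 := by
    rw [mp_inl.measureReal_preimage m1.nullMeasurableSet]; exact cheb_norm hv hη
  have b2 : (gpi (D3 n p) v).real ((fun (g : D3 n p → ℝ) k => g (.inr (.inl k))) ⁻¹' A2) ≤ 2 * v^2 * p / (η^2/2)^2 := by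
    have := ((mp_inl (A := Fin p) (B := Unit) (v := v)).comp (mp_inr (A := Fin n) (B := Fin p ⊕ Unit) (v := v))).measureReal_preimage m2.nullMeasurableSet
    refine (this.le).trans (cheb_norm hv (by positivity))
  have b3 : (gpi (D3 n p) v).real ((fun (g : D3 n p → ℝ) k => g (.inr (.inl k))) ⁻¹' A3) ≤ v * (∑ k, w k ^ 2) / η^2 := by
    have := ((mp_inl (A := Fin p) (B := Unit) (v := v)).comp (mp_inr (A := Fin n) (B := Fin p ⊕ Unit) (v := v))).measureReal_preimage m3.nullMeasurableSet
    refine (this.le).trans (cheb_lf hv w hη)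
  have b4 : (gpi (D3 n p) v).real ((fun (g : D3 n p → ℝ) k => g (.inr (.inr k))) ⁻¹' A4) ≤ v * (∑ k : Unit, (1:ℝ) ^ 2) / η^2 := by
    have := ((mp_inr (A := Fin p) (B := Unit) (v := v)).comp (mp_inr (A := Fin n) (B := Fin p ⊕ Unit) (v := v))).measureReal_preimage m4.nullMeasurableSet
    refine (this.le).trans (cheb_lf hv _ hη)
  have sub : {g | ∃ s : SS n p, psi lam δ (dotp w s.1.2 ^ 2) + (2 * lam + 3) * η < cmpf lam w s g} ⊆ 
    (((fun (g : D3 n p → ℝ) k => g (.inl k)) ⁻¹' A1) ∪ ((fun (g : D3 n p → ℝ) k => g (.inr (.inl k))) ⁻¹' A2)) ∪ 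
     (((fun (g : D3 n p → ℝ) k => g (.inr (.inl k))) ⁻¹' A3) ∪ ((fun (g : D3 n p → ℝ) k => g (.inr (.inr k))) ⁻¹' A4)) := by
    rintro g ⟨s, hs⟩
    by_contra hg
    simp only [Set.mem_union, not_or, Set.mem_preimage, A1, A2, A3, A4, Set.mem_ofPred_eq, not_le] at hg
    obtain ⟨⟨g1, g2⟩, g3, g4⟩ := hg
    refine absurd hs (not_lt.2 (cmpf_le lam hlam w hw δ s g hη ?_ ?_ ?_ ?_))
    · refine Real.sqrt_le_iff.2 ⟨by positivity, ?_⟩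
      rw [hvr, inv_mul_cancel₀ hn0.ne'] at g1
      have := (abs_lt.1 g1).2
      nlinarith
    · refine Real.sqrt_le_iff.2 ⟨by positivity, ?_⟩
      have h := (abs_lt.1 g2).2
      rw [hvr, inv_mul_eq_div] at h
      have := Real.sq_sqrt hδ
      nlinarith [Real.sqrt_nonneg δ]
    · exact g3.le
    · simp only [lf, Finset.univ_unique, Finset.sum_singleton, one_mul] at g4
      exact g4.le
  have hw' : ∑ k, w k ^ 2 = 1 := by rw [← hw]; simp [dotp, pow_two]
  rw [hw'] at b3
  refine (measureReal_mono sub).trans ((measureReal_union_le _ _).trans ((add_le_add ((measureReal_union_le _ _).trans (add_le_add b1 b2)) ((measureReal_union_le _ _).trans (add_le_add b3 b4))).trans ?_))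
  rw [hvr]
  simp only [Finset.univ_unique, Finset.sum_const, Finset.card_singleton, one_smul, one_pow, mul_one]
  have h5 : 2 * ((n:ℝ)⁻¹)^2 * p / (η^2/2)^2 ≤ (8 * (δ + η^2/2) / η^4) / n := by
    have : 2 * ((n:ℝ)⁻¹)^2 * p / (η^2/2)^2 = (8 * ((p:ℝ)/n) / η^4) / n := by field_simp; ring
    rw [this]
    gcongr
  have h6 : 2 * ((n:ℝ)⁻¹)^2 * n / η^2 + (n:ℝ)⁻¹ / η^2 + (n:ℝ)⁻¹ / η^2 = (2/η^2 + 2/η^2) / n := by field_simp; ring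
  have h7 : (2 / η^2 + 8 * (δ + η^2/2) / η^4 + 2 / η^2) / n = (2/η^2 + 2/η^2) / n + (8 * (δ + η^2/2) / η^4) / n := by ring
  rw [h7]; linarith

/-- Part U. -/
lemma partU (δ : ℝ) (hδ : 0 ≤ δ) (lam : ℝ) (hlam0 : 0 < lam) (p : ℕ → ℕ)
    (hp : Tendsto (fun n : ℕ => (p n : ℝ) / (n : ℝ)) atTop (nhds δ))
    (vstar : ∀ n : ℕ, Fin (p n) → ℝ) (hvstar : ∀ n, dotp (vstar n) (vstar n) = 1) {ε : ℝ} (hε : 0 < ε) : 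
    Tendsto (fun n : ℕ => (spikedLaw n (p n)).real {uZ | ∃ s : SS n (p n), 
      psi lam δ (dotp (vstar n) s.1.2 ^ 2) + ε < bil lam (vstar n) uZ.1 uZ.2 s.1.1 s.1.2}) atTop (nhds 0) := by
  let η := ε / (2 * (2 * lam + 3))
  have hη : 0 < η := by positivity
  have hηε : (2 * lam + 3) * η = ε / 2 := by simp only [η]; field_simp
  have t0 : Tendsto (fun n : ℕ => 4 * ((2 / η^2 + 8 * (δ + η^2/2) / η^4 + 2 / η^2) / (n:ℝ))) atTop (nhds 0) := by
    have := (tendsto_const_div_atTop_nhds_zero_nat (2 / η^2 + 8 * (δ + η^2/2) / η^4 + 2 / η^2)).const_mul 4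
    rwa [mul_zero] at this
  have ev : ∀ᶠ n : ℕ in atTop, (p n : ℝ) / n ≤ δ + η^2/2 := 
    (hp.eventually (gt_mem_nhds (by linarith [pow_pos hη 2] : δ < δ + η^2/2))).mono fun n h => h.le
  refine squeeze_zero' (Eventually.of_forall fun n => measureReal_nonneg) ?_ t0
  filter_upwards [ev, eventually_ne_atTop 0] with n hn hn0
  have S := slep_spiked lam (vstar n) hn0 (fun s : SS n (p n) => psi lam δ (dotp (vstar n) s.1.2 ^ 2) + ε) 
    (by unfold psi dotp; fun_prop) (half_pos hε)
  refine S.trans (mul_le_mul_of_nonneg_left ?_ (by norm_num))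
  have := cmp_prob hn0 lam hlam0 (vstar n) (hvstar n) δ hδ hη hn
  rw [hηε] at this
  refine le_trans (le_of_eq ?_) this
  congr 1; ext g; simp only [Set.mem_ofPred_eq]
  have : ∀ a : ℝ, a + ε - ε/2 = a + ε/2 := fun a => by ring
  simp_rw [this]


section res
variable {n p : ℕ}

/-- Gram matrix. -/
def Sm (y : Fin n → Fin p → ℝ) : Matrix (Fin p) (Fin p) ℝ := (Matrix.of y)ᵀ * Matrix.of y
/-- norm bound event -/
def GoodY (μ0 : ℝ) (y : Fin n → Fin p → ℝ) : Prop := 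
  ∀ x : Fin p → ℝ, (Matrix.of y *ᵥ x) ⬝ᵥ (Matrix.of y *ᵥ x) ≤ μ0 * (x ⬝ᵥ x)
def Tm (μ : ℝ) (y : Fin n → Fin p → ℝ) : Matrix (Fin p) (Fin p) ℝ := μ • 1 - Sm y
/-- resolvent -/
def Rm (μ : ℝ) (y : Fin n → Fin p → ℝ) : Matrix (Fin p) (Fin p) ℝ := (Tm μ y)⁻¹

variable {μ0 μ : ℝ} {y : Fin n → Fin p → ℝ}

lemma dp_nonneg {m : ℕ} (x : Fin m → ℝ) : 0 ≤ x ⬝ᵥ x := dotp_self_nonneg x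
lemma dp_cs {m : ℕ} (x z : Fin m → ℝ) : (x ⬝ᵥ z)^2 ≤ (x ⬝ᵥ x) * (z ⬝ᵥ z) := dotp_cs x z

lemma Sm_quad (x z : Fin p → ℝ) : x ⬝ᵥ (Sm y *ᵥ z) = (Matrix.of y *ᵥ x) ⬝ᵥ (Matrix.of y *ᵥ z) := by
  rw [Sm, ← mulVec_mulVec, dotProduct_mulVec, vecMul_transpose]

lemma Tm_quad (x z : Fin p → ℝ) : x ⬝ᵥ (Tm μ y *ᵥ z) = μ * (x ⬝ᵥ z) - (Matrix.of y *ᵥ x) ⬝ᵥ (Matrix.of y *ᵥ z) := by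
  rw [Tm, sub_mulVec, dotProduct_sub, Sm_quad, smul_mulVec, one_mulVec, dotProduct_smul, smul_eq_mul]

lemma Tm_ge (h : GoodY μ0 y) (x : Fin p → ℝ) : (μ - μ0) * (x ⬝ᵥ x) ≤ x ⬝ᵥ (Tm μ y *ᵥ x) := by
  rw [Tm_quad]; linarith [h x]

lemma Tm_symm : (Tm μ y)ᵀ = Tm μ y := by
  simp [Tm, Sm, transpose_mul]

lemma Rm_symm : (Rm μ y)ᵀ = Rm μ y := by
  rw [Rm, transpose_nonsing_inv, Tm_symm]

lemma Rm_swap (x z : Fin p → ℝ) : x ⬝ᵥ (Rm μ y *ᵥ z) = z ⬝ᵥ (Rm μ y *ᵥ x) := by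
  rw [dotProduct_mulVec, ← mulVec_transpose, Rm_symm, dotProduct_comm]

lemma Tm_unit (h : GoodY μ0 y) (hμ : μ0 < μ) : IsUnit (Tm μ y) := by
  rw [← mulVec_injective_iff_isUnit]
  intro a b hab
  have h1 : Tm μ y *ᵥ (a - b) = 0 := by rw [mulVec_sub]; simpa [sub_eq_zero] using hab
  have h2 := Tm_ge (μ := μ) h (a - b)
  rw [h1, dotProduct_zero] at h2
  have h3 : (a - b) ⬝ᵥ (a - b) = 0 := by nlinarith [dp_nonneg (a - b)]
  exact sub_eq_zero.1 (dotp_eq_zero h3)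

lemma TR (h : GoodY μ0 y) (hμ : μ0 < μ) : Tm μ y * Rm μ y = 1 := 
  mul_nonsing_inv _ ((isUnit_iff_isUnit_det _).1 (Tm_unit h hμ))
lemma RT (h : GoodY μ0 y) (hμ : μ0 < μ) : Rm μ y * Tm μ y = 1 := 
  nonsing_inv_mul _ ((isUnit_iff_isUnit_det _).1 (Tm_unit h hμ))

lemma R4 (h : GoodY μ0 y) (hμ : μ0 < μ) (z : Fin p → ℝ) : (μ - μ0) * ((Rm μ y *ᵥ z) ⬝ᵥ (Rm μ y *ᵥ z)) ≤ z ⬝ᵥ (Rm μ y *ᵥ z) := by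
  have := Tm_ge (μ := μ) h (Rm μ y *ᵥ z)
  rwa [mulVec_mulVec, TR h hμ, one_mulVec, dotProduct_comm _ z] at this

lemma R40 (h : GoodY μ0 y) (hμ : μ0 < μ) (z : Fin p → ℝ) : 0 ≤ z ⬝ᵥ (Rm μ y *ᵥ z) := 
  (mul_nonneg (sub_pos.2 hμ).le (dp_nonneg _)).trans (R4 h hμ z)

lemma R5 (h : GoodY μ0 y) (hμ : μ0 < μ) (z : Fin p → ℝ) : (Rm μ y *ᵥ z) ⬝ᵥ (Rm μ y *ᵥ z) ≤ (z ⬝ᵥ z) / (μ - μ0)^2 := by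
  have hk := sub_pos.2 hμ
  have h1 := R4 h hμ z
  have h2 := dp_cs z (Rm μ y *ᵥ z)
  have h3 := dp_nonneg (Rm μ y *ᵥ z)
  have h4 := dp_nonneg z
  rw [le_div_iff₀ (by positivity)]
  set a := (Rm μ y *ᵥ z) ⬝ᵥ (Rm μ y *ᵥ z)
  set b := z ⬝ᵥ (Rm μ y *ᵥ z)
  set c := z ⬝ᵥ z
  rcases h3.eq_or_lt with h0 | h0
  · rw [← h0]; simpa using h4
  · have : ((μ - μ0) * a)^2 ≤ b^2 := pow_le_pow_left₀ (by positivity) h1 2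
    have h5 : (a * (μ - μ0)^2) * a ≤ c * a := by nlinarith
    exact le_of_mul_le_mul_right h5 h0

lemma R6 (h : GoodY μ0 y) (hμ : μ0 < μ) (z : Fin p → ℝ) : z ⬝ᵥ (Rm μ y *ᵥ z) ≤ (z ⬝ᵥ z) / (μ - μ0) := by
  have hk := sub_pos.2 hμ
  have h1 := R5 h hμ z
  have h2 := dp_cs z (Rm μ y *ᵥ z)
  have h4 := dp_nonneg z
  refine abs_le_of_sq_le_sq' ?_ (by positivity) |>.2
  refine h2.trans ?_
  calc _ ≤ (z ⬝ᵥ z) * ((z ⬝ᵥ z) / (μ - μ0)^2) := mul_le_mul_of_nonneg_left h1 h4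
    _ = _ := by field_simp

lemma R7 (h : GoodY μ0 y) (i : Fin n) (h0 : 0 ≤ μ0) : y i ⬝ᵥ y i ≤ μ0 := by
  have h1 := h (y i)
  have h2 : (y i ⬝ᵥ y i)^2 ≤ (Matrix.of y *ᵥ y i) ⬝ᵥ (Matrix.of y *ᵥ y i) := by
    have := Finset.single_le_sum (f := fun k => (Matrix.of y *ᵥ y i) k * (Matrix.of y *ᵥ y i) k) (fun k _ => mul_self_nonneg _) (Finset.mem_univ i)
    rw [pow_two]; exact this
  have h3 := dp_nonneg (y i)
  by_contra hc
  push Not at hc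
  nlinarith

lemma good_update (h : GoodY μ0 y) (i : Fin n) : GoodY μ0 (Function.update y i 0) := by
  intro x
  refine le_trans (Finset.sum_le_sum fun k _ => ?_) (h x)
  by_cases hk : k = i
  · subst hk
    simp only [mulVec, Matrix.of_apply, Function.update_self, zero_dotProduct, mul_zero]
    exact mul_self_nonneg _
  · simp [mulVec, Matrix.of_apply, Function.update_of_ne hk]

lemma Sm_update (i : Fin n) : Sm y = Sm (Function.update y i 0) + vecMulVec (y i) (y i) := by
  ext a b
  simp only [Sm, mul_apply, transpose_apply, Matrix.of_apply, Matrix.add_apply, vecMulVec_apply]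
  rw [← Finset.add_sum_erase _ _ (Finset.mem_univ i), ← Finset.add_sum_erase _ (fun k => Function.update y i 0 k a * Function.update y i 0 k b) (Finset.mem_univ i)]
  simp only [Function.update_self, Pi.zero_apply, zero_mul, zero_add]
  rw [add_comm]; congr 1
  exact Finset.sum_congr rfl fun k hk => by rw [Function.update_of_ne (Finset.ne_of_mem_erase hk)]

lemma Tm_update (i : Fin n) : Tm μ (Function.update y i 0) = Tm μ y + vecMulVec (y i) (y i) := by
  rw [Tm, Tm, Sm_update (y := y) i]; abel

lemma Ry (h : GoodY μ0 y) (hμ : μ0 < μ) (i : Fin n) : 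
    Rm μ y *ᵥ y i = (1 + y i ⬝ᵥ (Rm μ y *ᵥ y i)) • (Rm μ (Function.update y i 0) *ᵥ y i) := by
  have h1 : Tm μ (Function.update y i 0) *ᵥ (Rm μ y *ᵥ y i) = (1 + y i ⬝ᵥ (Rm μ y *ᵥ y i)) • y i := by
    rw [Tm_update, add_mulVec, mulVec_mulVec, TR h hμ, one_mulVec, vecMulVec_mulVec, add_smul, one_smul]
    simp
  have h2 : Rm μ (Function.update y i 0) *ᵥ (Tm μ (Function.update y i 0) *ᵥ (Rm μ y *ᵥ y i)) = Rm μ (Function.update y i 0) *ᵥ ((1 + y i ⬝ᵥ (Rm μ y *ᵥ y i)) • y i) := by rw [h1]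
  rw [mulVec_mulVec (Rm μ y *ᵥ y i), RT (good_update h i) hμ, one_mulVec, mulVec_smul] at h2
  exact h2

/-- r = rho (1 + r) -/
lemma r_rho (h : GoodY μ0 y) (hμ : μ0 < μ) (i : Fin n) : 
    y i ⬝ᵥ (Rm μ y *ᵥ y i) = (y i ⬝ᵥ (Rm μ (Function.update y i 0) *ᵥ y i)) * (1 + y i ⬝ᵥ (Rm μ y *ᵥ y i)) := by
  conv_lhs => rw [Ry h hμ i, dotProduct_smul, smul_eq_mul, mul_comm]

lemma tr_diff (h : GoodY μ0 y) (hμ : μ0 < μ) (h0 : 0 ≤ μ0) (i : Fin n) : 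
    |(Rm μ y).trace - (Rm μ (Function.update y i 0)).trace| ≤ (1 + μ0 / (μ - μ0)) * (μ0 / (μ - μ0)^2) := by
  have hk := sub_pos.2 hμ
  have h' := good_update h i
  have e : Rm μ y - Rm μ (Function.update y i 0) = vecMulVec (Rm μ y *ᵥ y i) (Rm μ (Function.update y i 0) *ᵥ y i) := by
    have : Rm μ y * (Tm μ (Function.update y i 0) - Tm μ y) * Rm μ (Function.update y i 0) = Rm μ y - Rm μ (Function.update y i 0) := by
      rw [mul_sub, sub_mul, RT h hμ, one_mul, mul_assoc, TR h' hμ, mul_one]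
    rw [← this, Tm_update, add_sub_cancel_left, mul_vecMulVec, vecMulVec_mul, ← mulVec_transpose, Rm_symm]
  rw [← trace_sub, e, trace_vecMulVec, Ry h hμ i, smul_dotProduct, smul_eq_mul]
  have a1 := R40 h hμ (y i)
  have a2 := R6 h hμ (y i)
  have a3 := R7 h i h0
  have a4 := R5 h' hμ (y i)
  have a5 := dp_nonneg (Rm μ (Function.update y i 0) *ᵥ y i)
  rw [abs_of_nonneg (mul_nonneg (by linarith) a5)]
  have a6 : (y i ⬝ᵥ y i) / (μ - μ0) ≤ μ0 / (μ - μ0) := by gcongr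
  have a7 : (y i ⬝ᵥ y i) / (μ - μ0)^2 ≤ μ0 / (μ - μ0)^2 := by gcongr
  exact mul_le_mul (by linarith) (by linarith) a5 (by positivity)

lemma sum_r (h : GoodY μ0 y) (hμ : μ0 < μ) : ∑ i, y i ⬝ᵥ (Rm μ y *ᵥ y i) = μ * (Rm μ y).trace - p := by
  have e1 : ∑ i, y i ⬝ᵥ (Rm μ y *ᵥ y i) = (Matrix.of y * Rm μ y * (Matrix.of y)ᵀ).trace := by
    rw [trace]
    refine Finset.sum_congr rfl fun i _ => ?_
    rw [diag_apply, Matrix.mul_assoc, Matrix.mul_apply]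
    rfl
  rw [e1, trace_mul_comm, ← Matrix.mul_assoc]
  have e2 : (Matrix.of y)ᵀ * Matrix.of y = μ • 1 - Tm μ y := by simp [Tm, Sm]
  rw [e2, sub_mul, TR h hμ, trace_sub, Matrix.smul_mul, one_mul, trace_smul, trace_one]
  simp
end res


section prj
variable {n p : ℕ}

/-- projection orthogonal to `w` -/
def prj (w z : Fin p → ℝ) : Fin p → ℝ := fun j => z j - dotp z w * w j
/-- projection matrix -/
def Pj (w : Fin p → ℝ) : Matrix (Fin p) (Fin p) ℝ := 1 - vecMulVec w w

lemma Pj_mulVec (w z : Fin p → ℝ) : Pj w *ᵥ z = prj w z := by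
  rw [Pj, sub_mulVec, one_mulVec, vecMulVec_mulVec]
  ext j
  simp only [prj, Pi.sub_apply, dotp_comm z w]
  simp [dotp, dotProduct, mul_comm]

lemma Pj_symm (w : Fin p → ℝ) : (Pj w)ᵀ = Pj w := by
  simp [Pj, transpose_vecMulVec]

lemma prj_zero (w : Fin p → ℝ) : prj w 0 = 0 := by
  ext j; simp [prj, dotp]

lemma prj_orth {w : Fin p → ℝ} (hw : dotp w w = 1) (z : Fin p → ℝ) : prj w z ⬝ᵥ w = 0 := by
  have : prj w z = z - dotp z w • w := by ext j; simp [prj]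
  rw [this, sub_dotProduct, smul_dotProduct]
  change dotp z w - dotp z w * dotp w w = 0
  rw [hw]; ring

lemma prj_norm {w : Fin p → ℝ} (hw : dotp w w = 1) (z : Fin p → ℝ) : prj w z ⬝ᵥ prj w z ≤ z ⬝ᵥ z := by
  have h : prj w z = z - dotp z w • w := by ext j; simp [prj]
  have h2 : prj w z ⬝ᵥ prj w z = prj w z ⬝ᵥ z := by
    have : prj w z ⬝ᵥ prj w z = prj w z ⬝ᵥ (z - dotp z w • w) := congrArg _ h
    rw [this, dotProduct_sub, dotProduct_smul, prj_orth hw, smul_zero, sub_zero]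
  have h3 : prj w z ⬝ᵥ z = z ⬝ᵥ z - (dotp z w)^2 := by
    rw [h, sub_dotProduct, smul_dotProduct]
    change _ - dotp z w * dotp w z = _
    rw [dotp_comm w z]; ring
  rw [h2, h3]; nlinarith [sq_nonneg (dotp z w)]

lemma Pj_sq {w : Fin p → ℝ} (hw : dotp w w = 1) : Pj w * Pj w = Pj w := by
  have : vecMulVec w w * vecMulVec w w = vecMulVec w w := by
    rw [vecMulVec_mul_vecMulVec]
    change vecMulVec w (dotp w w • w) = _
    rw [hw, one_smul]
  rw [Pj, sub_mul, mul_sub, one_mul, mul_sub, mul_one, this]; simp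

/-- sandwiched resolvent -/
def PRP (w : Fin p → ℝ) (μ : ℝ) (y : Fin n → Fin p → ℝ) : Matrix (Fin p) (Fin p) ℝ := Pj w * Rm μ y * Pj w

lemma PRP_symm (w : Fin p → ℝ) (μ : ℝ) (y : Fin n → Fin p → ℝ) : (PRP w μ y)ᵀ = PRP w μ y := by
  rw [PRP, transpose_mul, transpose_mul, Pj_symm, Rm_symm, mul_assoc]

lemma qf_eq (A : Matrix (Fin p) (Fin p) ℝ) (z : Fin p → ℝ) : qf (fun i j => A i j) z = z ⬝ᵥ (A *ᵥ z) := by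
  simp only [qf, dotProduct, mulVec, Finset.mul_sum]
  exact Finset.sum_congr rfl fun i _ => Finset.sum_congr rfl fun j _ => by ring

lemma qf_PRP (w : Fin p → ℝ) (μ : ℝ) (y : Fin n → Fin p → ℝ) (z : Fin p → ℝ) : 
    qf (fun i j => PRP w μ y i j) z = prj w z ⬝ᵥ (Rm μ y *ᵥ prj w z) := by
  rw [qf_eq, PRP, ← mulVec_mulVec, ← mulVec_mulVec, dotProduct_mulVec, ← mulVec_transpose, Pj_symm, Pj_mulVec]

lemma tr_PRP {w : Fin p → ℝ} (hw : dotp w w = 1) (μ : ℝ) (y : Fin n → Fin p → ℝ) : 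
    ∑ i, PRP w μ y i i = (Rm μ y).trace - w ⬝ᵥ (Rm μ y *ᵥ w) := by
  change (PRP w μ y).trace = _
  rw [PRP, mul_assoc, trace_mul_comm, mul_assoc, Pj_sq hw, Pj, mul_sub, mul_one, trace_sub, mul_vecMulVec, trace_vecMulVec, dotProduct_comm]

lemma frob_PRP {w : Fin p → ℝ} (hw : dotp w w = 1) {μ0 μ : ℝ} {y : Fin n → Fin p → ℝ} (h : GoodY μ0 y) (hμ : μ0 < μ) :
    ∑ i, ∑ j, PRP w μ y i j ^ 2 ≤ p / (μ - μ0)^2 := by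
  rw [Finset.sum_comm]
  have : ∀ j ∈ Finset.univ, ∑ i, PRP w μ y i j ^ 2 ≤ 1 / (μ - μ0)^2 := by
    intro j _
    have e : ∀ i, PRP w μ y i j = (PRP w μ y *ᵥ (Pi.single j 1)) i := by intro i; simp
    simp only [e, pow_two]
    change (PRP w μ y *ᵥ (Pi.single j 1)) ⬝ᵥ (PRP w μ y *ᵥ (Pi.single j 1)) ≤ _
    rw [PRP, ← mulVec_mulVec, ← mulVec_mulVec, Pj_mulVec, Pj_mulVec]
    refine (prj_norm hw _).trans ((R5 h hμ _).trans ?_)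
    rw [← pow_two]
    gcongr
    refine (prj_norm hw _).trans ?_
    simp
  refine (Finset.sum_le_card_nsmul _ _ _ this).trans (le_of_eq ?_)
  simp; ring

lemma var_rho {w : Fin p → ℝ} (hw : dotp w w = 1) {μ0 μ : ℝ} {y : Fin n → Fin p → ℝ} (h : GoodY μ0 y) (hμ : μ0 < μ) {v : ℝ≥0} (hv : v ≠ 0) :
    ∫⁻ z, ENNReal.ofReal ((prj w z ⬝ᵥ (Rm μ y *ᵥ prj w z) - v * ((Rm μ y).trace - w ⬝ᵥ (Rm μ y *ᵥ w)))^2) ∂gpi (Fin p) v ≤ ENNReal.ofReal (2 * v^2 * (p / (μ - μ0)^2)) := by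
  simp only [← qf_PRP, ← tr_PRP hw]
  rw [← ofReal_integral_eq_lintegral_ofReal]
  · apply ENNReal.ofReal_le_ofReal
    refine (le_of_eq (var_qf hv (fun i j => PRP w μ y i j) (fun i j => ?_))).trans ?_
    · have := congrFun (congrFun (PRP_symm w μ y) j) i
      exact this
    · exact mul_le_mul_of_nonneg_left (frob_PRP hw h hμ) (by positivity)
  · have a : AM (gpi (Fin p) v) (fun z => qf (fun i j => PRP w μ y i j) z - v * ∑ i, PRP w μ y i i) := (AM.qf _ ).sub (AM.const _)
    have := (a.mul a).integrable
    simpa only [pow_two] using this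
  · exact ae_of_all _ fun z => sq_nonneg _
end prj


section meas
variable {n p : ℕ}

lemma cont_of : Continuous fun y : Fin n → Fin p → ℝ => (Matrix.of y : Matrix (Fin n) (Fin p) ℝ) := continuous_id

lemma closed_GoodY (μ0 : ℝ) : IsClosed {y : Fin n → Fin p → ℝ | GoodY μ0 y} := by
  have : {y : Fin n → Fin p → ℝ | GoodY μ0 y} = ⋂ x : Fin p → ℝ, {y | (Matrix.of y *ᵥ x) ⬝ᵥ (Matrix.of y *ᵥ x) ≤ μ0 * (x ⬝ᵥ x)} := by
    ext y; simp [GoodY]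
  rw [this]
  refine isClosed_iInter fun x => isClosed_le ?_ continuous_const
  have h : Continuous fun y : Fin n → Fin p → ℝ => Matrix.of y *ᵥ x := cont_of.matrix_mulVec continuous_const
  exact h.dotProduct h

lemma meas_Rm (μ : ℝ) (a b : Fin p) : Measurable fun y : Fin n → Fin p → ℝ => Rm μ y a b := by
  have hT : Continuous fun y : Fin n → Fin p → ℝ => Tm μ y := 
    continuous_const.sub (cont_of.matrix_transpose.matrix_mul cont_of)
  have e : (fun y : Fin n → Fin p → ℝ => Rm μ y a b) = fun y => ((Tm μ y).det)⁻¹ * (Tm μ y).adjugate a b := by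
    ext y
    rw [Rm, Matrix.inv_def, Ring.inverse_eq_inv']; rfl
  rw [e]
  exact (hT.matrix_det.measurable.inv).mul (hT.matrix_adjugate.matrix_elem a b).measurable

lemma cont_prj (w : Fin p → ℝ) : Continuous (prj w) := by
  unfold prj dotp; fun_prop

/-- projected rows -/
def Yp (w : Fin p → ℝ) (Z : Fin n → Fin p → ℝ) : Fin n → Fin p → ℝ := fun i => prj w (Z i)

lemma cont_Yp (w : Fin p → ℝ) : Continuous (Yp (n := n) w) := 
  continuous_pi fun i => (cont_prj w).comp (continuous_apply i)

lemma Yp_update (w : Fin p → ℝ) (Z : Fin n → Fin p → ℝ) (i : Fin n) : Yp w (Function.update Z i 0) = Function.update (Yp w Z) i 0 := by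
  ext k j
  by_cases hk : k = i
  · subst hk; simp [Yp, prj_zero]
  · simp [Yp, Function.update_of_ne hk]

/-- leave-one-out fluctuation -/
def xiR (μ : ℝ) (w : Fin p → ℝ) (v : ℝ) (i : Fin n) (Z : Fin n → Fin p → ℝ) : ℝ := 
  prj w (Z i) ⬝ᵥ (Rm μ (Yp w (Function.update Z i 0)) *ᵥ prj w (Z i)) 
    - v * ((Rm μ (Yp w (Function.update Z i 0))).trace - w ⬝ᵥ (Rm μ (Yp w (Function.update Z i 0)) *ᵥ w))

lemma meas_quad {Ω : Type*} [MeasurableSpace Ω] {m k : ℕ} {f : Ω → Fin m → ℝ} {g : Ω → Fin k → ℝ} {A : Ω → Matrix (Fin m) (Fin k) ℝ} (hf : Measurable f) (hg : Measurable g)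
    (hA : ∀ a b, Measurable fun x => A x a b) : Measurable fun x => f x ⬝ᵥ (A x *ᵥ g x) := by
  simp only [dotProduct, mulVec]
  refine Finset.measurable_fun_sum _ fun i _ => (measurable_pi_iff.1 hf i).mul ?_
  exact Finset.measurable_fun_sum _ fun j _ => (hA i j).mul (measurable_pi_iff.1 hg j)

lemma cont_upd (i : Fin n) : Continuous fun Z : Fin n → Fin p → ℝ => Function.update Z i 0 := 
  continuous_id.update i continuous_const

lemma meas_xiR (μ : ℝ) (w : Fin p → ℝ) (v : ℝ) (i : Fin n) : Measurable (xiR μ w v i) := by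
  have h1 : Measurable fun Z : Fin n → Fin p → ℝ => Yp w (Function.update Z i 0) := ((cont_Yp w).comp (cont_upd i)).measurable
  have h2 : Measurable fun Z : Fin n → Fin p → ℝ => prj w (Z i) := ((cont_prj w).comp (continuous_apply i)).measurable
  have h3 := fun a b => (meas_Rm (n := n) μ a b).comp h1
  unfold xiR
  refine (meas_quad h2 h2 h3).sub (((?_ : Measurable _).sub (meas_quad measurable_const measurable_const h3)).const_mul v)
  simp only [trace, diag_apply]
  exact Finset.measurable_fun_sum _ fun j _ => h3 j j

/-- truncated squared fluctuation -/
def xiE (μ0 μ : ℝ) (w : Fin p → ℝ) (v : ℝ) (i : Fin n) : (Fin n → Fin p → ℝ) → ℝ≥0∞ := 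
  Set.indicator {Z | GoodY μ0 (Yp w (Function.update Z i 0))} (fun Z => ENNReal.ofReal (xiR μ w v i Z ^ 2))

lemma meas_xiE (μ0 μ : ℝ) (w : Fin p → ℝ) (v : ℝ) (i : Fin n) : Measurable (xiE μ0 μ w v i) := by
  refine Measurable.indicator ((meas_xiR μ w v i).pow_const 2).ennreal_ofReal ?_
  exact ((closed_GoodY μ0).preimage ((cont_Yp w).comp (cont_upd i))).measurableSet

lemma int_xiE {μ0 μ : ℝ} (hμ : μ0 < μ) {w : Fin p → ℝ} (hw : dotp w w = 1) {v : ℝ≥0} (hv : v ≠ 0) (i : Fin n) : 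
    ∫⁻ Z, xiE μ0 μ w v i Z ∂(Measure.pi fun _ : Fin n => gpi (Fin p) v) ≤ ENNReal.ofReal (2 * v^2 * (p / (μ - μ0)^2)) := by
  have mp := mp_update (fun _ : Fin n => gpi (Fin p) v) i
  have hm : Measurable (fun q : (Fin n → Fin p → ℝ) × (Fin p → ℝ) => xiE μ0 μ w v i (Function.update q.1 i q.2)) := (meas_xiE μ0 μ w v i).comp mp.measurable
  rw [← mp.lintegral_comp (meas_xiE μ0 μ w v i), lintegral_prod _ hm.aemeasurable]
  have : ∀ Z : Fin n → Fin p → ℝ, ∫⁻ z, xiE μ0 μ w v i (Function.update Z i z) ∂(gpi (Fin p) v) ≤ ENNReal.ofReal (2 * v^2 * (p / (μ - μ0)^2)) := by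
    intro Z
    by_cases hG : GoodY μ0 (Yp w (Function.update Z i 0))
    · refine le_trans (le_of_eq (lintegral_congr fun z => ?_)) (var_rho hw hG hμ hv)
      rw [xiE, Set.indicator_of_mem (by simpa using hG)]
      simp [xiR]
    · refine le_trans (le_of_eq ?_) zero_le
      have : ∀ z, xiE μ0 μ w v i (Function.update Z i z) = 0 := fun z => by
        rw [xiE, Set.indicator_of_notMem (by simpa using hG)]
      simp [this]
  refine (lintegral_mono this).trans ?_
  simp

lemma prob_xi {μ0 μ : ℝ} (hμ : μ0 < μ) {w : Fin p → ℝ} (hw : dotp w w = 1) {v : ℝ≥0} (hv : v ≠ 0) {c : ℝ} (hc : 0 < c) : 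
    (Measure.pi fun _ : Fin n => gpi (Fin p) v) {Z | ENNReal.ofReal c ≤ ∑ i, xiE μ0 μ w v i Z} ≤ ENNReal.ofReal (n * (2 * v^2 * (p / (μ - μ0)^2)) / c) := by
  refine (meas_ge_le_lintegral_div (Finset.measurable_fun_sum _ fun i _ => meas_xiE μ0 μ w v i).aemeasurable (by simpa using hc) ENNReal.ofReal_ne_top).trans ?_
  rw [ENNReal.ofReal_div_of_pos hc]
  gcongr
  rw [lintegral_finsetSum _ fun i _ => meas_xiE μ0 μ w v i]
  refine (Finset.sum_le_sum fun i _ => int_xiE hμ hw hv i).trans ?_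
  rw [Finset.sum_const, ENNReal.ofReal_mul (by positivity)]
  simp
end meas


section Q
variable {n p : ℕ} {μ0 μ : ℝ}

/-- companion matrix -/
def Qm (μ : ℝ) (y : Fin n → Fin p → ℝ) (i j : Fin n) : ℝ := y i ⬝ᵥ (Rm μ y *ᵥ y j)

lemma frob_Q {y : Fin n → Fin p → ℝ} (h : GoodY μ0 y) (hμ : μ0 < μ) (h0 : 0 ≤ μ0) : 
    ∑ i, ∑ j, Qm μ y i j ^ 2 ≤ n * (μ0 * (μ0 / (μ - μ0)^2)) := by
  rw [Finset.sum_comm]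
  have : ∀ j ∈ Finset.univ, ∑ i, Qm μ y i j ^ 2 ≤ μ0 * (μ0 / (μ - μ0)^2) := by
    intro j _
    simp only [pow_two (Qm _ _ _ _)]
    change (Matrix.of y *ᵥ (Rm μ y *ᵥ y j)) ⬝ᵥ (Matrix.of y *ᵥ (Rm μ y *ᵥ y j)) ≤ _
    refine (h _).trans ?_
    gcongr
    refine (R5 h hμ _).trans ?_
    gcongr
    exact R7 h j h0
  refine (Finset.sum_le_card_nsmul _ _ _ this).trans (le_of_eq ?_)
  simp

lemma meas_Q (w : Fin p → ℝ) (i j : Fin n) : Measurable fun Z : Fin n → Fin p → ℝ => Qm μ (Yp w Z) i j := by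
  have h := (cont_Yp (n := n) w).measurable
  exact meas_quad (measurable_pi_iff.1 h i) (measurable_pi_iff.1 h j) (fun a b => (meas_Rm μ a b).comp h)

lemma prob_zeta (hμ : μ0 < μ) (h0 : 0 ≤ μ0) (w : Fin p → ℝ) {v : ℝ≥0} (hv : v ≠ 0) {η : ℝ} (hη : 0 < η) :
    ((gpi (Fin n) v).prod (Measure.pi fun _ : Fin n => gpi (Fin p) v)) 
      {uZ | GoodY μ0 (Yp w uZ.2) ∧ η ≤ |qf (Qm μ (Yp w uZ.2)) uZ.1 - v * ∑ i, Qm μ (Yp w uZ.2) i i|} ≤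
      ENNReal.ofReal (2 * v^2 * (n * (μ0 * (μ0 / (μ - μ0)^2))) / η^2) := by
  have m1 : Measurable fun uZ : (Fin n → ℝ) × (Fin n → Fin p → ℝ) => qf (Qm μ (Yp w uZ.2)) uZ.1 - v * ∑ i, Qm μ (Yp w uZ.2) i i := by
    have q := fun i j => (meas_Q (μ := μ) w i j).comp (measurable_snd : Measurable fun uZ : (Fin n → ℝ) × (Fin n → Fin p → ℝ) => uZ.2)
    have c := fun i => (measurable_pi_apply i).comp (measurable_fst : Measurable fun uZ : (Fin n → ℝ) × (Fin n → Fin p → ℝ) => uZ.1)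
    refine Measurable.sub ?_ (Measurable.const_mul ?_ _)
    · exact Finset.measurable_fun_sum _ fun i _ => Finset.measurable_fun_sum _ fun j _ => ((q i j).mul (c i)).mul (c j)
    · exact Finset.measurable_fun_sum _ fun i _ => q i i
  have m2 : MeasurableSet {uZ : (Fin n → ℝ) × (Fin n → Fin p → ℝ) | GoodY μ0 (Yp w uZ.2) ∧ η ≤ |qf (Qm μ (Yp w uZ.2)) uZ.1 - v * ∑ i, Qm μ (Yp w uZ.2) i i|} := by
    refine MeasurableSet.inter ?_ (measurableSet_le measurable_const m1.abs)
    exact ((closed_GoodY μ0).preimage ((cont_Yp w).comp continuous_snd)).measurableSet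
  rw [Measure.prod_apply_symm m2]
  refine (lintegral_mono (g := fun _ => ENNReal.ofReal (2 * v^2 * (n * (μ0 * (μ0 / (μ - μ0)^2))) / η^2)) fun Z => ?_).trans (by simp)
  by_cases hG : GoodY μ0 (Yp w Z)
  · have hf : AM (gpi (Fin n) v) (fun u => qf (Qm μ (Yp w Z)) u - v * ∑ i, Qm μ (Yp w Z) i i) := (AM.qf _).sub (AM.const _)
    have := cheb hf hη
    rw [var_qf hv _ (fun i j => by exact Rm_swap _ _)] at this
    have h2 : (gpi (Fin n) v).real {u | η ≤ |qf (Qm μ (Yp w Z)) u - v * ∑ i, Qm μ (Yp w Z) i i|} ≤ 2 * v^2 * (n * (μ0 * (μ0 / (μ - μ0)^2))) / η^2 := by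
      refine this.trans ?_
      gcongr
      exact frob_Q hG hμ h0
    rw [← ENNReal.ofReal_le_ofReal_iff (by positivity), ofReal_measureReal] at h2
    refine le_trans (measure_mono ?_) h2
    intro u hu
    exact hu.2
  · refine le_trans (le_of_eq ?_) zero_le
    have : (fun u : Fin n → ℝ => (u, Z)) ⁻¹' {uZ : (Fin n → ℝ) × (Fin n → Fin p → ℝ) | GoodY μ0 (Yp w uZ.2) ∧ η ≤ |qf (Qm μ (Yp w uZ.2)) uZ.1 - v * ∑ i, Qm μ (Yp w uZ.2) i i|} = ∅ := by
      ext u; simp [hG]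
    change (gpi (Fin n) v) _ = 0
    rw [this]; simp
end Q


section det
variable {n p : ℕ} {μ0 μ : ℝ}

/-- rotated spiked matrix rows -/
def Xr (s : ℝ) (w : Fin p → ℝ) (u : Fin n → ℝ) (y : Fin n → Fin p → ℝ) : Fin n → Fin p → ℝ := fun i j => s * u i * w j + y i j

lemma Xr_mulVec (s : ℝ) (w : Fin p → ℝ) (u : Fin n → ℝ) (y : Fin n → Fin p → ℝ) (x : Fin p → ℝ) : 
    Matrix.of (Xr s w u y) *ᵥ x = (s * (w ⬝ᵥ x)) • u + Matrix.of y *ᵥ x := by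
  ext i
  simp only [mulVec, dotProduct, Xr, Matrix.of_apply, Pi.add_apply, Pi.smul_apply, smul_eq_mul, Finset.mul_sum, Finset.sum_mul, ← Finset.sum_add_distrib]
  exact Finset.sum_congr rfl fun j _ => by ring

lemma Yp_orth {w : Fin p → ℝ} (hw : dotp w w = 1) (Z : Fin n → Fin p → ℝ) : Matrix.of (Yp w Z) *ᵥ w = 0 := by
  ext i; exact prj_orth hw (Z i)

lemma det_good {s : ℝ} {w : Fin p → ℝ} (hw : dotp w w = 1) {u : Fin n → ℝ} {Z : Fin n → Fin p → ℝ} 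
    (h0 : 0 ≤ μ0) (h : GoodY μ0 (Xr s w u (Yp w Z))) : GoodY μ0 (Yp w Z) := by
  intro x
  have h1 := h (prj w x)
  have e : prj w x = x - dotp x w • w := by ext j; simp [prj]
  rw [Xr_mulVec, dotProduct_comm w, prj_orth hw, mul_zero, zero_smul, zero_add] at h1
  have e2 : Matrix.of (Yp w Z) *ᵥ prj w x = Matrix.of (Yp w Z) *ᵥ x := by
    rw [e, mulVec_sub, mulVec_smul, Yp_orth hw]; simp
  rw [e2] at h1
  exact h1.trans (mul_le_mul_of_nonneg_left (prj_norm hw x) h0)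

lemma det_test {s : ℝ} {w : Fin p → ℝ} (hw : dotp w w = 1) {u : Fin n → ℝ} {Z : Fin n → Fin p → ℝ} 
    (h0 : 0 ≤ μ0) (hμ : μ0 < μ) (h : GoodY μ0 (Xr s w u (Yp w Z))) : 
    s^2 * (u ⬝ᵥ u + qf (Qm μ (Yp w Z)) u) ≤ μ := by
  have hY := det_good hw h0 h
  set y := Yp w Z with hy
  set a := Rm μ y *ᵥ ((Matrix.of y)ᵀ *ᵥ u) with ha
  have hTa : Tm μ y *ᵥ a = (Matrix.of y)ᵀ *ᵥ u := by
    rw [ha, mulVec_mulVec ((Matrix.of y)ᵀ *ᵥ u), TR hY hμ, one_mulVec]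
  have hyw : Matrix.of y *ᵥ w = 0 := Yp_orth hw Z
  have hTw : Tm μ y *ᵥ w = μ • w := by
    rw [Tm, sub_mulVec, Sm, ← mulVec_mulVec, hyw, mulVec_zero, smul_mulVec, one_mulVec, sub_zero]
  have hwa : w ⬝ᵥ a = 0 := by
    have h1 : w ⬝ᵥ (Tm μ y *ᵥ a) = μ * (w ⬝ᵥ a) := by
      rw [dotProduct_mulVec, ← mulVec_transpose, Tm_symm, hTw, smul_dotProduct, smul_eq_mul]
    rw [hTa, dotProduct_mulVec, vecMul_transpose, hyw, zero_dotProduct] at h1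
    have : μ ≠ 0 := by linarith
    simpa [this] using h1.symm
  have hq : qf (Qm μ y) u = u ⬝ᵥ (Matrix.of y *ᵥ a) := by
    have e : Matrix.of y *ᵥ a = Matrix.of (Qm μ y) *ᵥ u := by
      rw [ha, mulVec_mulVec, mulVec_mulVec]
      congr 1
      ext i j
      rw [Matrix.mul_assoc, Matrix.mul_apply]
      rfl
    rw [e]
    simp only [qf, dotProduct, mulVec, Finset.mul_sum, Matrix.of_apply]
    exact Finset.sum_congr rfl fun i _ => Finset.sum_congr rfl fun j _ => by ring
  have hq2 : u ⬝ᵥ (Matrix.of y *ᵥ a) = μ * (a ⬝ᵥ a) - (Matrix.of y *ᵥ a) ⬝ᵥ (Matrix.of y *ᵥ a) := by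
    rw [← Tm_quad, hTa, dotProduct_mulVec, ← mulVec_transpose, dotProduct_comm]
  have hw' : w ⬝ᵥ w = 1 := hw
  have h1 := h (w + s • a)
  rw [Xr_mulVec] at h1
  rw [mulVec_add, hyw, zero_add, mulVec_smul] at h1
  have e1 : w ⬝ᵥ (w + s • a) = 1 := by rw [dotProduct_add, dotProduct_smul, hwa, hw']; simp
  have e2 : (w + s • a) ⬝ᵥ (w + s • a) = 1 + s^2 * (a ⬝ᵥ a) := by
    rw [add_dotProduct, e1, smul_dotProduct, dotProduct_add, dotProduct_comm a w, hwa, dotProduct_smul]; simp; ring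
  rw [e1, e2, mul_one, ← smul_add, smul_dotProduct, dotProduct_smul, add_dotProduct, dotProduct_add, dotProduct_add, dotProduct_comm (Matrix.of y *ᵥ a) u] at h1
  simp only [smul_eq_mul] at h1
  rw [hq]
  have h3 := dp_nonneg a
  have h4 : 0 ≤ (μ - μ0) * (1 + s^2 * (a ⬝ᵥ a)) := mul_nonneg (by linarith) (by positivity)
  set b := u ⬝ᵥ (Matrix.of y *ᵥ a)
  set c := (Matrix.of y *ᵥ a) ⬝ᵥ (Matrix.of y *ᵥ a)
  have h5 : s^2 * b = s^2 * (μ * (a ⬝ᵥ a) - c) := by rw [hq2]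
  nlinarith

lemma det_rbar {w : Fin p → ℝ} (hw : dotp w w = 1) {Z : Fin n → Fin p → ℝ} 
    (h0 : 0 ≤ μ0) (hμ : μ0 < μ) (h : GoodY μ0 (Yp w Z)) (hn : 0 < n) {η v r : ℝ} (hη : 0 ≤ η) (hv : v * n = 1) 
    (hx : ∑ i, xiR μ w v i Z ^ 2 ≤ n * η^2) (hr : r = v * ∑ i, Qm μ (Yp w Z) i i) : 
    0 ≤ r ∧ r ≤ μ0 / (μ - μ0) ∧ |μ * r - (r + v * p) * (1 + r)| ≤ 
      μ * ((1 + μ0 / (μ - μ0)) * (η + v * ((1 + μ0 / (μ - μ0)) * (μ0 / (μ - μ0)^2) + 1 / (μ - μ0)))) := by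
  have hk := sub_pos.2 hμ
  have hn' : (0:ℝ) < n := by exact_mod_cast hn
  have hv0 : 0 < v := by by_contra hc; push Not at hc; nlinarith
  set y := Yp w Z with hy
  set K := μ0 / (μ - μ0) with hK
  have hK0 : 0 ≤ K := by positivity
  set C := (1 + K) * (μ0 / (μ - μ0)^2) + 1 / (μ - μ0) with hC
  set q : Fin n → ℝ := fun i => y i ⬝ᵥ (Rm μ y *ᵥ y i) with hq
  have hr' : r = v * ∑ i, q i := hr
  have q0 : ∀ i, 0 ≤ q i := fun i => R40 h hμ _
  have qK : ∀ i, q i ≤ K := fun i => (R6 h hμ _).trans (by rw [hK]; gcongr; exact R7 h i h0)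
  have hsum : ∑ i, q i ≤ n * K := by
    refine (Finset.sum_le_card_nsmul _ _ K fun i _ => qK i).trans (le_of_eq (by simp))
  refine ⟨hr' ▸ mul_nonneg hv0.le (Finset.sum_nonneg fun i _ => q0 i), ?_, ?_⟩
  · rw [hr']; calc _ ≤ v * (n * K) := by gcongr
      _ = K := by rw [← mul_assoc, hv, one_mul]
  set t := (Rm μ y).trace with ht
  have hsr : ∑ i, q i = μ * t - p := sum_r h hμ
  set e : Fin n → ℝ := fun i => y i ⬝ᵥ (Rm μ (Function.update y i 0) *ᵥ y i) - v * t with he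
  have he1 : ∀ i, |e i| ≤ |xiR μ w v i Z| + v * C := by
    intro i
    have a1 := tr_diff h hμ h0 i
    have a2 := R40 (good_update h i) hμ w
    have a3 := R6 (good_update h i) hμ w
    have hw' : w ⬝ᵥ w = 1 := hw
    rw [hw'] at a3
    have e1 : e i = xiR μ w v i Z - v * ((t - (Rm μ (Function.update y i 0)).trace) + w ⬝ᵥ (Rm μ (Function.update y i 0) *ᵥ w)) := by
      rw [he, xiR, Yp_update]
      change y i ⬝ᵥ _ - _ = y i ⬝ᵥ (Rm μ (Function.update y i 0) *ᵥ y i) - _ - _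
      ring
    rw [e1]
    refine (abs_sub _ _).trans ?_
    gcongr
    rw [abs_mul, abs_of_pos hv0]
    gcongr
    refine (abs_add_le _ _).trans ?_
    rw [hC, abs_of_nonneg a2]
    exact add_le_add a1 a3
  have hre : ∀ i, q i = (v * t + e i) * (1 + q i) := by
    intro i
    have := r_rho h hμ i
    rw [he]; simp only [add_sub_cancel]; exact this
  have hmain : r = v * t * (1 + r) + v * ∑ i, e i * (1 + q i) := by
    have : ∑ i, q i = ∑ i, (v * t + v * t * q i + e i * (1 + q i)) := Finset.sum_congr rfl fun i _ => by
      linear_combination hre i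
    rw [Finset.sum_add_distrib, Finset.sum_add_distrib, ← Finset.mul_sum (f := q), Finset.sum_const] at this
    simp only [Finset.card_univ, Fintype.card_fin, nsmul_eq_mul] at this
    have h2 : v * ∑ i, q i = (v * n) * (v * t) + v * t * (v * ∑ i, q i) + v * ∑ i, e i * (1 + q i) := by
      linear_combination v * this
    rw [hv, ← hr'] at h2
    linarith
  have hxi : ∑ i, |xiR μ w v i Z| ≤ n * η := by
    have cs := sq_sum_le_card_mul_sum_sq (s := (Finset.univ : Finset (Fin n))) (f := fun i => |xiR μ w v i Z|)
    simp only [sq_abs, Finset.card_univ, Fintype.card_fin] at cs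
    refine abs_le_of_sq_le_sq' ?_ (by positivity) |>.2
    nlinarith
  have herr : |v * ∑ i, e i * (1 + q i)| ≤ (1 + K) * (η + v * C) := by
    rw [abs_mul, abs_of_pos hv0]
    have h1 : |∑ i, e i * (1 + q i)| ≤ ∑ i, (|xiR μ w v i Z| + v * C) * (1 + K) := by
      refine (Finset.abs_sum_le_sum_abs _ _).trans (Finset.sum_le_sum fun i _ => ?_)
      rw [abs_mul, abs_of_nonneg (by linarith [q0 i] : 0 ≤ 1 + q i)]
      exact mul_le_mul (he1 i) (by linarith [qK i]) (by linarith [q0 i]) ((abs_nonneg _).trans (he1 i))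
    rw [← Finset.sum_mul, Finset.sum_add_distrib, Finset.sum_const] at h1
    simp only [Finset.card_univ, Fintype.card_fin, nsmul_eq_mul] at h1
    calc _ ≤ v * ((n * η + n * (v * C)) * (1 + K)) := by
          gcongr
          refine h1.trans ?_
          gcongr
      _ = (v * n) * ((η + v * C) * (1 + K)) := by ring
      _ = _ := by rw [hv]; ring
  have hfin : μ * r - (r + v * p) * (1 + r) = μ * (v * ∑ i, e i * (1 + q i)) := by
    have : μ * (v * t) = r + v * p := by rw [hr', hsr]; ring
    rw [← this]
    linear_combination μ * hmain
  rw [hfin, abs_mul, abs_of_pos (by linarith : 0 < μ)]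
  exact mul_le_mul_of_nonneg_left herr (by linarith)
end det


section lawid
variable {n p : ℕ} {μ0 : ℝ}

/-- coefficient array of a spiked matrix -/
def coef (c : ℝ) (w : Fin p → ℝ) (M : Fin p → Fin p → ℝ) (q : Fin n × Fin p) : D0 n p → ℝ := 
  Sum.elim (fun k => if q.1 = k then c * w q.2 else 0) (fun kl => if q.1 = kl.1 then M q.2 kl.2 else 0)

lemma coef_lin (c : ℝ) (w : Fin p → ℝ) (M : Fin p → Fin p → ℝ) (q : Fin n × Fin p) (g : D0 n p → ℝ) : 
    ∑ k, coef c w M q k * g k = c * g (.inl q.1) * w q.2 + ∑ l, M q.2 l * g (.inr (q.1, l)) := by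
  rw [Fintype.sum_sum_type, Fintype.sum_prod_type]
  simp only [coef, Sum.elim_inl, Sum.elim_inr, ite_mul, zero_mul]
  congr 1
  · simp; ring
  · rw [Finset.sum_comm]; simp

lemma coef_cov (c : ℝ) (w : Fin p → ℝ) (M : Fin p → Fin p → ℝ) (q q' : Fin n × Fin p) : 
    ∑ k, coef c w M q k * coef c w M q' k = if q'.1 = q.1 then c^2 * (w q.2 * w q'.2) + ∑ l, M q.2 l * M q'.2 l else 0 := by
  rw [coef_lin]
  simp only [coef, Sum.elim_inl, Sum.elim_inr]
  split_ifs
  · ring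
  · simp

lemma law_coef {c : ℝ} {w : Fin p → ℝ} (hw : dotp w w = 1) {s : ℝ} (hs : s^2 = 1 + c^2) (v : ℝ≥0) : 
    (gpi (D0 n p) v).map (fun g i => ∑ k, coef c w (fun a b => if a = b then 1 else 0) i k * g k) = 
    (gpi (D0 n p) v).map (fun g i => ∑ k, coef s w (fun a b => (if a = b then 1 else 0) - w a * w b) i k * g k) := by
  refine law_eq v _ _ fun i j => ?_
  rw [coef_cov, coef_cov]
  split_ifs with h
  · have : ∑ l, ((if i.2 = l then 1 else 0) - w i.2 * w l) * ((if j.2 = l then 1 else 0) - w j.2 * w l) = (if j.2 = i.2 then 1 else 0) - w i.2 * w j.2 := by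
      simp only [sub_mul, mul_sub, Finset.sum_sub_distrib, ite_mul, mul_ite, zero_mul, one_mul, mul_one, mul_zero, Finset.sum_ite_eq, Finset.mem_univ, if_true]
      have : ∑ x, w i.2 * w x * (w j.2 * w x) = w i.2 * w j.2 := by
        calc _ = w i.2 * w j.2 * dotp w w := by
              rw [dotp, Finset.mul_sum]; exact Finset.sum_congr rfl fun x _ => by ring
          _ = _ := by rw [hw, mul_one]
      rw [this]; simp only [eq_comm (a := i.2)]; ring
    rw [this, hs]
    simp only [ite_mul, zero_mul, one_mul, Finset.sum_ite_eq, Finset.mem_univ, if_true]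
    ring
  · rfl

lemma law_good {c : ℝ} {w : Fin p → ℝ} (hw : dotp w w = 1) {s : ℝ} (hs : s^2 = 1 + c^2) : 
    spikedLaw n p {uZ | GoodY μ0 (Xr c w uZ.1 uZ.2)} = spikedLaw n p {uZ | GoodY μ0 (Xr s w uZ.1 (Yp w uZ.2))} := by
  have cX : ∀ t : ℝ, Continuous fun uZ : (Fin n → ℝ) × (Fin n → Fin p → ℝ) => Xr t w uZ.1 uZ.2 := by
    intro t; unfold Xr; fun_prop
  have m1 : MeasurableSet {uZ : (Fin n → ℝ) × (Fin n → Fin p → ℝ) | GoodY μ0 (Xr c w uZ.1 uZ.2)} := 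
    ((closed_GoodY μ0).preimage (cX c)).measurableSet
  have m2 : MeasurableSet {uZ : (Fin n → ℝ) × (Fin n → Fin p → ℝ) | GoodY μ0 (Xr s w uZ.1 (Yp w uZ.2))} := 
    ((closed_GoodY μ0).preimage ((cX s).comp (continuous_fst.prodMk ((cont_Yp w).comp continuous_snd)))).measurableSet
  have mB : MeasurableSet {h : Fin n × Fin p → ℝ | GoodY μ0 (fun i j => h (i, j))} := 
    ((closed_GoodY μ0).preimage (by fun_prop)).measurableSet
  have mp := mp_flat n p
  rw [← mp.measure_preimage m1.nullMeasurableSet, ← mp.measure_preimage m2.nullMeasurableSet]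
  have h := congrArg (fun m => m {h : Fin n × Fin p → ℝ | GoodY μ0 (fun i j => h (i, j))}) (law_coef (n := n) hw hs (n : ℝ≥0)⁻¹)
  rw [Measure.map_apply (meas_linmap _) mB, Measure.map_apply (meas_linmap _) mB] at h
  convert h using 2
  · ext g
    simp only [Set.mem_preimage, Set.mem_ofPred_eq, coef_lin]
    have : (Xr c w (fun i => g (.inl i)) fun i j => g (.inr (i, j))) = fun i j => c * g (Sum.inl i) * w j + ∑ l, (if j = l then 1 else 0) * g (Sum.inr (i, l)) := by
      ext i j; simp [Xr]
    rw [this]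
  · ext g
    simp only [Set.mem_preimage, Set.mem_ofPred_eq, coef_lin]
    have : (Xr s w (fun i => g (.inl i)) (Yp w fun i j => g (.inr (i, j)))) = fun i j => s * g (Sum.inl i) * w j + ∑ l, ((if j = l then 1 else 0) - w j * w l) * g (Sum.inr (i, l)) := by
      ext i j
      simp only [Xr, Yp, prj, dotp, sub_mul, Finset.sum_sub_distrib, ite_mul, zero_mul, one_mul, Finset.sum_ite_eq, Finset.mem_univ, if_true, Finset.sum_mul]
      congr 2
      exact Finset.sum_congr rfl fun l _ => by ring
    rw [this]
end lawid


section partL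

lemma choose_b {δ lam μ0 : ℝ} (hδ : 0 ≤ δ) (hlam : 0 < lam) (hδl : δ < lam^4) (hμ0 : μ0 < (1 + lam^2) * (1 + δ / lam^2)) : 
    ∃ b : ℝ, 0 < b ∧ b < lam^2 ∧ δ ≤ b^2 ∧ μ0 < (1 + b) * (1 + δ / b) := by
  have hl : 0 < lam^2 := by positivity
  have c1 : ContinuousAt (fun b : ℝ => (1 + b) * (1 + δ / b)) (lam^2) := by
    have : lam^2 ≠ 0 := hl.ne'
    fun_prop (disch := assumption)
  have c2 : ContinuousAt (fun b : ℝ => b^2) (lam^2) := by fun_prop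
  have e1 := c1.eventually (lt_mem_nhds hμ0)
  have e2 := c2.eventually (lt_mem_nhds (show δ < (lam^2)^2 by rw [← pow_mul]; exact hδl))
  have e3 := lt_mem_nhds hl
  have e4 : ∀ᶠ b in nhdsWithin (lam^2) (Set.Iio (lam^2)), 0 < b ∧ b < lam^2 ∧ δ ≤ b^2 ∧ μ0 < (1 + b) * (1 + δ / b) := by
    filter_upwards [nhdsWithin_le_nhds e1, nhdsWithin_le_nhds e2, nhdsWithin_le_nhds e3, self_mem_nhdsWithin] with b h1 h2 h3 h4
    exact ⟨h3, h4, h2.le, h1⟩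
  exact e4.exists

lemma quad_root {δ b r d E η : ℝ} (hb : 0 < b) (hδ : δ ≤ b^2) (hr : 0 ≤ r) {K : ℝ} (hrK : r ≤ K) (hη : 0 < η)
    (h1 : |((1 + b) * (1 + δ / b)) * r - (r + d) * (1 + r)| ≤ E) (h2 : E + |d - δ| * (1 + K) < η^2) : 
    δ / b - η ≤ r := by
  by_contra hc
  push Not at hc
  have h3 : δ / b ≤ b := by rw [div_le_iff₀ hb]; nlinarith
  have h4 : η^2 < (δ / b - r) * (b - r) := by nlinarith
  have h5 : (δ / b - r) * (b - r) = -(((1 + b) * (1 + δ / b)) * r - (r + d) * (1 + r)) + (δ - d) * (1 + r) := by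
    field_simp; ring
  have h6 := neg_le_abs (((1 + b) * (1 + δ / b)) * r - (r + d) * (1 + r))
  have h7 : (δ - d) * (1 + r) ≤ |d - δ| * (1 + K) := by
    refine mul_le_mul ?_ (by linarith) (by linarith) (abs_nonneg _)
    rw [abs_sub_comm]; exact le_abs_self _
  linarith

variable {n p : ℕ}

lemma not_event {δ lam μ0 b : ℝ} (hδ : 0 ≤ δ) (h0 : 0 ≤ μ0) (hb : 0 < b) (hδb : δ ≤ b^2) {μ : ℝ} (hμdef : μ = (1 + b) * (1 + δ / b)) (hμ : μ0 < μ) 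
    {s : ℝ} (hs : s^2 = 1 + lam^2) {w : Fin p → ℝ} (hw : dotp w w = 1) (hn : 0 < n) {v : ℝ≥0} (hv : v * (n:ℝ) = 1)
    {η η' : ℝ} (hη : 0 < η) (hη' : 0 < η') (hηs : s^2 * (3 * η) < lam^2 - b)
    (hsm : μ * ((1 + μ0 / (μ - μ0)) * (η' + v * ((1 + μ0 / (μ - μ0)) * (μ0 / (μ - μ0)^2) + 1 / (μ - μ0)))) + |v * p - δ| * (1 + μ0 / (μ - μ0)) < η^2)
    {u : Fin n → ℝ} {Z : Fin n → Fin p → ℝ} (hE : GoodY μ0 (Xr s w u (Yp w Z))) : 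
    ENNReal.ofReal (n * η'^2) ≤ ∑ i, xiE μ0 μ w v i Z ∨ 
    (GoodY μ0 (Yp w Z) ∧ η ≤ |qf (Qm μ (Yp w Z)) u - v * ∑ i, Qm μ (Yp w Z) i i|) ∨ η ≤ |dotp u u - v * n| := by
  by_contra hc
  push Not at hc
  obtain ⟨h1, h2, h3⟩ := hc
  have hG := det_good hw h0 hE
  have hn' : (0:ℝ) < n := by exact_mod_cast hn
  have hx : ∑ i, xiR μ w v i Z ^ 2 ≤ n * η'^2 := by
    have e : ∑ i, xiE μ0 μ w v i Z = ENNReal.ofReal (∑ i, xiR μ w v i Z ^ 2) := by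
      rw [ENNReal.ofReal_sum_of_nonneg fun i _ => sq_nonneg _]
      refine Finset.sum_congr rfl fun i _ => ?_
      rw [xiE, Set.indicator_of_mem]
      rw [Set.mem_ofPred_eq, Yp_update]
      exact good_update hG i
    rw [e] at h1
    exact ((ENNReal.ofReal_lt_ofReal_iff (by positivity)).1 h1).le
  obtain ⟨r0, rK, rq⟩ := det_rbar hw h0 hμ hG hn hη'.le hv hx rfl
  have h4 := h2 hG
  have h5 := det_test hw h0 hμ hE
  set r := (v:ℝ) * ∑ i, Qm μ (Yp w Z) i i
  rw [hμdef] at rq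
  rw [hμdef] at hsm
  rw [hμdef] at rK
  have h6 := quad_root hb hδb r0 rK hη rq hsm
  rw [hv] at h3
  have h3' := (abs_lt.1 h3).1
  have h4' := (abs_lt.1 h4).1
  have h7 : 1 + δ / b - 3 * η ≤ u ⬝ᵥ u + qf (Qm μ (Yp w Z)) u := by
    change _ ≤ dotp u u + _
    linarith
  have h8 : s^2 * (1 + δ / b - 3 * η) ≤ μ := le_trans (mul_le_mul_of_nonneg_left h7 (sq_nonneg s)) h5
  have h9 : 0 ≤ δ / b := by positivity
  have h10 : 0 < lam^2 - b := lt_of_le_of_lt (by positivity) hηs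
  rw [hμdef, mul_sub] at h8
  rw [hs] at h8 hηs
  nlinarith [mul_nonneg h10.le h9]

lemma prob_event {δ lam μ0 b : ℝ} (hδ : 0 ≤ δ) (h0 : 0 ≤ μ0) (hb : 0 < b) (hδb : δ ≤ b^2) {μ : ℝ} (hμdef : μ = (1 + b) * (1 + δ / b)) (hμ : μ0 < μ) 
    {s : ℝ} (hs : s^2 = 1 + lam^2) {w : Fin p → ℝ} (hw : dotp w w = 1) (hn : 0 < n)
    {η η' : ℝ} (hη : 0 < η) (hη' : 0 < η') (hηs : s^2 * (3 * η) < lam^2 - b)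
    (hsm : μ * ((1 + μ0 / (μ - μ0)) * (η' + (n:ℝ)⁻¹ * ((1 + μ0 / (μ - μ0)) * (μ0 / (μ - μ0)^2) + 1 / (μ - μ0)))) + |(n:ℝ)⁻¹ * p - δ| * (1 + μ0 / (μ - μ0)) < η^2) :
    spikedLaw n p {uZ | GoodY μ0 (Xr lam w uZ.1 uZ.2)} ≤ 
      ENNReal.ofReal (2 * (p / n) * (n:ℝ)⁻¹ / ((μ - μ0)^2 * η'^2)) + (ENNReal.ofReal (2 * (μ0 * (μ0 / (μ - μ0)^2)) / η^2 * (n:ℝ)⁻¹) + ENNReal.ofReal (2 / η^2 * (n:ℝ)⁻¹)) := by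
  have hn' : (0:ℝ) < n := by exact_mod_cast hn
  set v : ℝ≥0 := (n:ℝ≥0)⁻¹ with hvd
  have hvr : (v:ℝ) = (n:ℝ)⁻¹ := by simp [hvd]
  have hv0 : v ≠ 0 := by rw [hvd]; simp; omega
  have hv : v * (n:ℝ) = 1 := by rw [hvr]; field_simp
  rw [law_good hw hs]
  have hsub : {uZ : (Fin n → ℝ) × (Fin n → Fin p → ℝ) | GoodY μ0 (Xr s w uZ.1 (Yp w uZ.2))} ⊆ 
      (Prod.snd ⁻¹' {Z | ENNReal.ofReal (n * η'^2) ≤ ∑ i, xiE μ0 μ w v i Z}) ∪ 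
      ({uZ | GoodY μ0 (Yp w uZ.2) ∧ η ≤ |qf (Qm μ (Yp w uZ.2)) uZ.1 - v * ∑ i, Qm μ (Yp w uZ.2) i i|} ∪
      (Prod.fst ⁻¹' {u | η ≤ |dotp u u - v * n|})) := by
    intro uZ h
    exact not_event hδ h0 hb hδb hμdef hμ hs hw hn hv hη hη' hηs (by rw [hvr]; exact hsm) h
  refine (measure_mono hsub).trans ((measure_union_le _ _).trans (add_le_add ?_ ((measure_union_le _ _).trans (add_le_add ?_ ?_))))
  · have m : MeasurableSet {Z : Fin n → Fin p → ℝ | ENNReal.ofReal (n * η'^2) ≤ ∑ i, xiE μ0 μ w v i Z} := 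
      measurableSet_le measurable_const (Finset.measurable_fun_sum _ fun i _ => meas_xiE μ0 μ w v i)
    have mp : MeasurePreserving Prod.snd (spikedLaw n p) (Measure.pi fun _ : Fin n => gpi (Fin p) v) := measurePreserving_snd
    rw [mp.measure_preimage m.nullMeasurableSet]
    refine (prob_xi hμ hw hv0 (by positivity)).trans (ENNReal.ofReal_le_ofReal (le_of_eq ?_))
    rw [hvr]
    have := sub_pos.2 hμ
    field_simp
  · refine le_trans (prob_zeta hμ h0 w hv0 hη) (ENNReal.ofReal_le_ofReal (le_of_eq ?_))
    rw [hvr]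
    have := sub_pos.2 hμ
    field_simp
  · have m : MeasurableSet {u : Fin n → ℝ | η ≤ |dotp u u - v * n|} := by
      refine measurableSet_le measurable_const (Continuous.measurable ?_)
      unfold dotp; fun_prop
    have mp : MeasurePreserving Prod.fst (spikedLaw n p) (gpi (Fin n) v) := measurePreserving_fst
    rw [mp.measure_preimage m.nullMeasurableSet]
    have := cheb_norm (m := n) hv0 hη
    rw [← ENNReal.ofReal_le_ofReal_iff (by positivity), ofReal_measureReal] at this
    refine this.trans (ENNReal.ofReal_le_ofReal (le_of_eq ?_))
    rw [hvr]
    field_simp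

theorem partL (δ : ℝ) (hδ : 0 ≤ δ) (lam : ℝ) (hlam0 : 0 < lam) (hδl : δ < lam^4) (p : ℕ → ℕ)
    (hp : Tendsto (fun n : ℕ => (p n : ℝ) / (n : ℝ)) atTop (nhds δ))
    (vstar : ∀ n : ℕ, Fin (p n) → ℝ)
    (hvstar : ∀ n, dotp (vstar n) (vstar n) = 1) {μ0 : ℝ} (h0 : 0 ≤ μ0) (hμ0 : μ0 < (1 + lam^2) * (1 + δ / lam^2)) : 
    Tendsto (fun n => spikedLaw n (p n) {uZ | GoodY μ0 (Xr lam (vstar n) uZ.1 uZ.2)}) atTop (nhds 0) := by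
  obtain ⟨b, hb, hbl, hδb, hμ⟩ := choose_b hδ hlam0 hδl hμ0
  obtain ⟨μ, hμdef⟩ : ∃ μ, μ = (1 + b) * (1 + δ / b) := ⟨_, rfl⟩
  rw [← hμdef] at hμ
  have hk := sub_pos.2 hμ
  have hμp : 0 < μ := by linarith
  obtain ⟨s, hs⟩ : ∃ s : ℝ, s^2 = 1 + lam^2 := ⟨√(1 + lam^2), Real.sq_sqrt (by positivity)⟩
  obtain ⟨K, hK⟩ : ∃ K, K = μ0 / (μ - μ0) := ⟨_, rfl⟩
  have hK0 : 0 ≤ K := by rw [hK]; positivity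
  have hl : 0 < lam^2 - b := by linarith
  have hs0 : 0 < s^2 := by rw [hs]; positivity
  have hs1 : s ≠ 0 := fun h => by simp [h] at hs0
  obtain ⟨η, hη, hηs⟩ : ∃ η, 0 < η ∧ s^2 * (3 * η) < lam^2 - b := by
    refine ⟨(lam^2 - b) / (4 * s^2), by positivity, ?_⟩
    have : s^2 * (3 * ((lam^2 - b) / (4 * s^2))) = 3 / 4 * (lam^2 - b) := by field_simp
    rw [this]; linarith
  obtain ⟨η', hη', hηη⟩ : ∃ η', 0 < η' ∧ μ * ((1 + K) * η') < η^2 := by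
    refine ⟨η^2 / (2 * μ * (1 + K)), by positivity, ?_⟩
    have : μ * ((1 + K) * (η^2 / (2 * μ * (1 + K)))) = η^2 / 2 := by field_simp
    rw [this]; linarith [pow_pos hη 2]
  have tn : Tendsto (fun n : ℕ => (n:ℝ)⁻¹) atTop (nhds 0) := tendsto_inv_atTop_nhds_zero_nat
  have hp' : Tendsto (fun n : ℕ => (n:ℝ)⁻¹ * p n) atTop (nhds δ) := by
    refine hp.congr fun n => ?_
    rw [div_eq_inv_mul]
  have hsm : ∀ᶠ n : ℕ in atTop, μ * ((1 + μ0 / (μ - μ0)) * (η' + (n:ℝ)⁻¹ * ((1 + μ0 / (μ - μ0)) * (μ0 / (μ - μ0)^2) + 1 / (μ - μ0)))) + |(n:ℝ)⁻¹ * p n - δ| * (1 + μ0 / (μ - μ0)) < η^2 := by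
    have t : Tendsto (fun n : ℕ => μ * ((1 + μ0 / (μ - μ0)) * (η' + (n:ℝ)⁻¹ * ((1 + μ0 / (μ - μ0)) * (μ0 / (μ - μ0)^2) + 1 / (μ - μ0)))) + |(n:ℝ)⁻¹ * p n - δ| * (1 + μ0 / (μ - μ0))) atTop 
        (nhds (μ * ((1 + μ0 / (μ - μ0)) * (η' + 0 * ((1 + μ0 / (μ - μ0)) * (μ0 / (μ - μ0)^2) + 1 / (μ - μ0)))) + |δ - δ| * (1 + μ0 / (μ - μ0)))) := 
      ((((tn.mul_const _).const_add _).const_mul _).const_mul _).add (((hp'.sub_const δ).abs).mul_const _)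
    refine t.eventually (gt_mem_nhds ?_)
    rw [← hK]
    simpa using hηη
  have lim : Tendsto (fun n : ℕ => ENNReal.ofReal (2 * (p n / n) * (n:ℝ)⁻¹ / ((μ - μ0)^2 * η'^2)) + (ENNReal.ofReal (2 * (μ0 * (μ0 / (μ - μ0)^2)) / η^2 * (n:ℝ)⁻¹) + ENNReal.ofReal (2 / η^2 * (n:ℝ)⁻¹))) atTop (nhds 0) := by
    have a1 : Tendsto (fun n : ℕ => 2 * (p n / n) * (n:ℝ)⁻¹ / ((μ - μ0)^2 * η'^2)) atTop (nhds (2 * δ * 0 / ((μ - μ0)^2 * η'^2))) := 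
      ((hp.const_mul 2).mul tn).div_const _
    have a2 : Tendsto (fun n : ℕ => 2 * (μ0 * (μ0 / (μ - μ0)^2)) / η^2 * (n:ℝ)⁻¹) atTop (nhds (2 * (μ0 * (μ0 / (μ - μ0)^2)) / η^2 * 0)) := tn.const_mul _
    have a3 : Tendsto (fun n : ℕ => 2 / η^2 * (n:ℝ)⁻¹) atTop (nhds (2 / η^2 * 0)) := tn.const_mul _
    have := (ENNReal.tendsto_ofReal a1).add ((ENNReal.tendsto_ofReal a2).add (ENNReal.tendsto_ofReal a3))
    simpa using this
  refine tendsto_of_tendsto_of_tendsto_of_le_of_le' tendsto_const_nhds lim (Eventually.of_forall fun _ => zero_le) ?_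
  filter_upwards [hsm, eventually_gt_atTop 0] with n h1 h2
  exact prob_event hδ h0 hb hδb hμdef hμ hs (hvstar n) h2 hη hη' hηs h1
end partL


section partF

lemma rayleigh {n p : ℕ} (X : Matrix (Fin n) (Fin p) ℝ) {v : Fin p → ℝ} (h : IsTopUnitEigenvector (Xᵀ * X) v) (x : Fin p → ℝ) : 
    (X *ᵥ x) ⬝ᵥ (X *ᵥ x) ≤ ((X *ᵥ v) ⬝ᵥ (X *ᵥ v)) * (x ⬝ᵥ x) := by
  obtain ⟨hv, c, hc, hmax⟩ := h
  have q : ∀ z, z ⬝ᵥ ((Xᵀ * X) *ᵥ z) = (X *ᵥ z) ⬝ᵥ (X *ᵥ z) := by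
    intro z
    rw [← mulVec_mulVec, dotProduct_mulVec, vecMul_transpose]
  have hc2 : (X *ᵥ v) ⬝ᵥ (X *ᵥ v) = c := by
    rw [← q, hc, dotProduct_smul]
    change c * dotp v v = c
    rw [hv, mul_one]
  have hH : (c • (1 : Matrix (Fin p) (Fin p) ℝ) - Xᵀ * X).IsHermitian := by
    rw [IsHermitian, conjTranspose_eq_transpose_of_trivial]
    simp [transpose_mul]
  have hP : (c • (1 : Matrix (Fin p) (Fin p) ℝ) - Xᵀ * X).PosSemidef := by
    rw [hH.posSemidef_iff_eigenvalues_nonneg]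
    intro i
    have e := hH.mulVec_eigenvectorBasis i
    have ne : (hH.eigenvectorBasis i).ofLp ≠ 0 := by
      intro h0
      have := hH.eigenvectorBasis.orthonormal.ne_zero i
      exact this (by ext j; exact congrFun h0 j)
    rw [sub_mulVec, smul_mulVec, one_mulVec] at e
    have := hmax (c - hH.eigenvalues i) _ ne (by rw [sub_smul, ← e]; simp)
    simp only [Pi.zero_apply]
    linarith
  have := hP.dotProduct_mulVec_nonneg x
  rw [sub_mulVec, dotProduct_sub, smul_mulVec, one_mulVec, dotProduct_smul, star_trivial, q] at this
  rw [hc2]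
  simp only [smul_eq_mul] at this
  linarith

lemma psi_lt {δ lam t : ℝ} (hδ : 0 ≤ δ) (hlam : 0 < lam) (ht0 : 0 ≤ t) (ht1 : t ≤ 1) (hne : t ≠ (1 - δ / lam^4) / (1 + δ / lam^2)) : 
    psi lam δ t < √((1 + lam^2) * (1 + δ / lam^2)) := by
  apply Real.lt_sqrt_of_sq_lt
  unfold psi
  set A := √(1 + lam^2 * t) with hA
  set k := √δ / lam with hk
  set B := lam * √(1 - t) with hB
  have eA : A^2 = 1 + lam^2 * t := Real.sq_sqrt (by positivity)
  have eB : B^2 = lam^2 * (1 - t) := by rw [hB, mul_pow, Real.sq_sqrt (by linarith)]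
  have ek : k^2 = δ / lam^2 := by rw [hk, div_pow, Real.sq_sqrt hδ]
  have e1 : √δ * √(1 - t) = k * B := by rw [hk, hB]; field_simp
  have e2 : (1 + lam^2) * (1 + δ / lam^2) = (A^2 + B^2) * (1 + k^2) := by rw [eA, eB, ek]; ring
  rw [e1, e2]
  have hne' : B - k * A ≠ 0 := by
    intro h0
    apply hne
    have : B^2 = k^2 * A^2 := by rw [← mul_pow, sub_eq_zero.1 h0]
    rw [eA, eB, ek] at this
    rw [eq_div_iff (by positivity)]
    field_simp at this ⊢
    nlinarith
  nlinarith [sq_nonneg (B - k * A), (sq_pos_of_ne_zero hne')]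

lemma psi_gap {δ lam ε : ℝ} (hδ : 0 ≤ δ) (hlam : 0 < lam) (hε : 0 < ε) : 
    ∃ c ε' : ℝ, 0 ≤ c ∧ 0 < ε' ∧ c < √((1 + lam^2) * (1 + δ / lam^2)) ∧ 
      ∀ t, 0 ≤ t → t ≤ 1 → ε < |√t - √((1 - δ / lam^4) / (1 + δ / lam^2))| → psi lam δ t + ε' ≤ c := by
  set ts := (1 - δ / lam^4) / (1 + δ / lam^2)
  set M := √((1 + lam^2) * (1 + δ / lam^2)) with hM
  have hMpos : 0 < M := Real.sqrt_pos.2 (by positivity)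
  have hK : IsCompact (Set.Icc (0:ℝ) 1 ∩ {t | ε ≤ |√t - √ts|}) := 
    isCompact_Icc.inter_right (isClosed_le continuous_const (by fun_prop))
  have hcont : ContinuousOn (psi lam δ) (Set.Icc (0:ℝ) 1 ∩ {t | ε ≤ |√t - √ts|}) := by
    apply Continuous.continuousOn; unfold psi; fun_prop
  rcases Set.eq_empty_or_nonempty (Set.Icc (0:ℝ) 1 ∩ {t | ε ≤ |√t - √ts|}) with he | hne
  · refine ⟨0, 1, le_rfl, one_pos, hMpos, fun t h0 h1 h => ?_⟩
    have : t ∈ Set.Icc (0:ℝ) 1 ∩ {t | ε ≤ |√t - √ts|} := ⟨⟨h0, h1⟩, h.le⟩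
    rw [he] at this
    exact absurd this (Set.notMem_empty t)
  · obtain ⟨t0, ht0, hmax⟩ := hK.exists_isMaxOn hne hcont
    have hlt : psi lam δ t0 < M := by
      refine psi_lt hδ hlam ht0.1.1 ht0.1.2 ?_
      intro h
      have h2 : ε ≤ |√t0 - √ts| := ht0.2
      have h3 : t0 = ts := h
      rw [h3, sub_self, abs_zero] at h2
      linarith
    have hpos : 0 ≤ psi lam δ t0 := by unfold psi; positivity
    refine ⟨(psi lam δ t0 + M) / 2, (M - psi lam δ t0) / 2, by positivity, by linarith, by linarith, fun t h0 h1 h => ?_⟩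
    have : psi lam δ t ≤ psi lam δ t0 := hmax ⟨⟨h0, h1⟩, h.le⟩
    linarith

lemma final_sub {n p : ℕ} {δ lam ε c ε' : ℝ} {w : Fin p → ℝ} (hw : dotp w w = 1) (hc : 0 ≤ c) {ts : ℝ}
    (hg : ∀ t, 0 ≤ t → t ≤ 1 → ε < |√t - √ts| → psi lam δ t + ε' ≤ c) 
    {u : Fin n → ℝ} {Z : Fin n → Fin p → ℝ} {v : Fin p → ℝ} 
    (hv : IsTopUnitEigenvector ((spikedMatrix lam w u Z)ᵀ * spikedMatrix lam w u Z) v) 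
    (h : ε < |(|dotp v w|) - √ts|) : 
    GoodY (c^2) (Xr lam w u Z) ∨ ∃ s : SS n p, psi lam δ (dotp w s.1.2 ^ 2) + ε' < bil lam w u Z s.1.1 s.1.2 := by
  by_contra hcon
  push Not at hcon
  obtain ⟨h1, h2⟩ := hcon
  have hvv : dotp v v = 1 := hv.1
  set X := spikedMatrix lam w u Z with hX
  have hXr : Matrix.of (Xr lam w u Z) = X := rfl
  have hR := rayleigh X hv
  set L := √((X *ᵥ v) ⬝ᵥ (X *ᵥ v)) with hL
  have hLsq : L^2 = (X *ᵥ v) ⬝ᵥ (X *ᵥ v) := Real.sq_sqrt (dp_nonneg _)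
  have hcL : c < L := by
    by_contra hle
    push Not at hle
    apply h1
    intro x
    rw [hXr]
    refine (hR x).trans (mul_le_mul_of_nonneg_right ?_ (dp_nonneg x))
    rw [← hLsq]
    exact pow_le_pow_left₀ (Real.sqrt_nonneg _) hle 2
  have hLpos : 0 < L := lt_of_le_of_lt hc hcL
  have hunit : dotp (L⁻¹ • (X *ᵥ v)) (L⁻¹ • (X *ᵥ v)) = 1 := by
    rw [dotp_smul_left, dotp_smul_right]
    change L⁻¹ * (L⁻¹ * ((X *ᵥ v) ⬝ᵥ (X *ᵥ v))) = 1
    rw [← hLsq]; field_simp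
  have h3 := h2 ⟨(L⁻¹ • (X *ᵥ v), v), hunit, hvv⟩
  have h4 : bil lam w u Z (L⁻¹ • (X *ᵥ v)) v = L := by
    rw [bil, dotp_smul_left]
    change L⁻¹ * ((X *ᵥ v) ⬝ᵥ (X *ᵥ v)) = L
    rw [← hLsq]; field_simp
  simp only [h4] at h3
  have h5 : dotp w v ^ 2 ≤ 1 := by
    have := dotp_cs w v
    rw [hw, hvv] at this; linarith
  have h6 := hg (dotp w v ^ 2) (sq_nonneg _) h5 (by rw [Real.sqrt_sq_eq_abs, dotp_comm w v]; exact h)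
  linarith
end partF

/-- **Supercritical spiked model (BBP).** If `p/n → δ ≥ 0` and the fixed signal strength `λ`
satisfies `λ > δ^{1/4}`, then the absolute inner product between the top unit eigenvector `v̂`
of `XᵀX` and the spike direction `v*` converges in probability to
`√((1 − δ/λ⁴)/(1 + δ/λ²))`. -/
theorem spiked_pca_supercritical
    (δ : ℝ) (hδ : 0 ≤ δ) (lam : ℝ) (hlam0 : 0 < lam) (hlam : δ ^ ((1 : ℝ) / 4) < lam)
    (p : ℕ → ℕ)
    (hp : Tendsto (fun n : ℕ => (p n : ℝ) / (n : ℝ)) atTop (nhds δ))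
    (vstar : ∀ n : ℕ, Fin (p n) → ℝ)
    (hvstar : ∀ n, dotp (vstar n) (vstar n) = 1)
    (vhat : ∀ n : ℕ, (Fin n → ℝ) → (Fin n → Fin (p n) → ℝ) → (Fin (p n) → ℝ))
    (hvhat_meas : ∀ n, Measurable fun uZ : (Fin n → ℝ) × (Fin n → Fin (p n) → ℝ) =>
      vhat n uZ.1 uZ.2)
    (hvhat : ∀ n u Z, IsTopUnitEigenvector
      ((spikedMatrix lam (vstar n) u Z)ᵀ * spikedMatrix lam (vstar n) u Z) (vhat n u Z)) :
    ∀ ε > (0 : ℝ), Tendsto (fun n : ℕ =>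
      spikedLaw n (p n) {uZ | ε <
        abs (|dotp (vhat n uZ.1 uZ.2) (vstar n)| -
          Real.sqrt ((1 - δ / lam ^ 4) / (1 + δ / lam ^ 2)))})
      atTop (nhds 0) := by
  intro ε hε
  have hδl : δ < lam^4 := by
    have h1 : (δ ^ ((1:ℝ)/4))^4 < lam^4 := pow_lt_pow_left₀ hlam (Real.rpow_nonneg hδ _) (by norm_num)
    rwa [← Real.rpow_natCast, ← Real.rpow_mul hδ, show (1:ℝ)/4 * ((4:ℕ):ℝ) = 1 by norm_num, Real.rpow_one] at h1
  obtain ⟨c, ε', hc, hε', hcM, hg⟩ := psi_gap (lam := lam) hδ hlam0 hε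
  have L := partL δ hδ lam hlam0 hδl p hp vstar hvstar (μ0 := c^2) (sq_nonneg c) ((Real.lt_sqrt hc).1 hcM)
  have U := partU δ hδ lam hlam0 p hp vstar hvstar hε'
  have U' : Tendsto (fun n => spikedLaw n (p n) {uZ | ∃ s : SS n (p n), psi lam δ (dotp (vstar n) s.1.2 ^ 2) + ε' < bil lam (vstar n) uZ.1 uZ.2 s.1.1 s.1.2}) atTop (nhds 0) := by
    have := ENNReal.tendsto_ofReal U
    rw [ENNReal.ofReal_zero] at this
    refine this.congr fun n => ?_
    have : IsProbabilityMeasure (spikedLaw n (p n)) := by unfold spikedLaw; infer_instance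
    exact ofReal_measureReal
  have S := L.add U'
  rw [add_zero] at S
  refine tendsto_of_tendsto_of_tendsto_of_le_of_le tendsto_const_nhds S (fun _ => zero_le) fun n => ?_
  refine le_trans (measure_mono ?_) (measure_union_le _ _)
  intro uZ h
  exact final_sub (hvstar n) hc hg (hvhat n uZ.1 uZ.2) h
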